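/- arXiv:2310.18971 — 2 statements merged into one kernel-verified Lean document; each statement's English description precedes it below -/
import Mathlib

section
/- Let f : G → G be a graph map. Then cl(R(f)) = AP(f) ∪ cl(P(f)). -/
open Set Function Filter Topology Metric

noncomputable section

/-- An open arc: a subspace homeomorphic to the open interval `(0,1)`. -/
def IsOpenArc {G : Type*} [TopologicalSpace G] (A : Set G) : Prop :=
  Nonempty (A ≃ₜ Set.Ioo (0 : ℝ) 1)

/-- A circle: a subspace homeomorphic to the unit circle. -/
def IsCircle {G : Type*} [TopologicalSpace G] (C : Set G) : Prop :=
  Nonempty (C ≃ₜ Metric.sphere (0 : ℂ) 1)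

/-- A (topological) graph: a non-degenerate compact connected metric space with a finite
vertex set `V` such that every connected component of the complement of `V` is an open arc,
and every circle contains at least three vertices. -/
structure IsTopGraph {G : Type*} [MetricSpace G] (V : Set G) : Prop where
  nontrivial : Nontrivial G
  compact : CompactSpace G
  connected : ConnectedSpace G
  finite_vertexSet : V.Finite
  component_openArc : ∀ x ∈ Vᶜ, IsOpenArc (connectedComponentIn Vᶜ x)
  circle_vertices : ∀ C : Set G, IsCircle C → 3 ≤ (C ∩ V).ncard

/-- The set of eventually periodic points: points with finite orbit. -/
def evPeriodicPts {G : Type*} (f : G → G) : Set G :=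
  {x | (Set.range fun n : ℕ => f^[n] x).Finite}

/-- `EP_n(f)`: points whose orbit contains at most `n` points. -/
def evPeriodicPtsLe {G : Type*} (f : G → G) (n : ℕ) : Set G :=
  {x | (Set.range fun i : ℕ => f^[i] x).encard ≤ n}

/-- The ω-limit set of a point `x` under `f`. -/
def omegaSet {G : Type*} [TopologicalSpace G] (f : G → G) (x : G) : Set G :=
  ⋂ i : ℕ, closure (Set.range fun n : ℕ => f^[n + i] x)

/-- The ω-limit set of `f`. -/
def omegaLimitSet {G : Type*} [TopologicalSpace G] (f : G → G) : Set G :=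
  ⋃ x : G, omegaSet f x

/-- The set of recurrent points of `f`. -/
def recurrentPts {G : Type*} [TopologicalSpace G] (f : G → G) : Set G :=
  {x | x ∈ omegaSet f x}

/-- The set of non-wandering points of `f`. -/
def nonwanderingPts {G : Type*} [TopologicalSpace G] (f : G → G) : Set G :=
  {x | ∀ U : Set G, IsOpen U → x ∈ U → ∃ n : ℕ, 0 < n ∧ (f^[n] '' U ∩ U).Nonempty}

/-- The set of almost periodic points of `f`. -/
def almostPeriodicPts {G : Type*} [TopologicalSpace G] (f : G → G) : Set G :=
  {x | ∀ U : Set G, IsOpen U → x ∈ U →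
    ∃ m : ℕ, 0 < m ∧ ∀ n : ℕ, ∃ i : ℕ, 1 ≤ i ∧ i ≤ m ∧ f^[n + i] x ∈ U}

/-- The ω-limit set of `x` under the restriction `f|K` (closures taken in the subspace `K`). -/
def omegaSetIn {G : Type*} [TopologicalSpace G] (f : G → G) (K : Set G) (x : G) : Set G :=
  ⋂ i : ℕ, (closure (Set.range fun n : ℕ => f^[n + i] x) ∩ K)

/-- The ω-limit set `ω(f|K)` of the restriction of `f` to `K`. -/
def omegaLimitSetIn {G : Type*} [TopologicalSpace G] (f : G → G) (K : Set G) : Set G :=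
  ⋃ x ∈ K, omegaSetIn f K x

/-- The non-wandering set `Ω(f|K)` of the restriction of `f` to `K`. -/
def nonwanderingPtsIn {G : Type*} [TopologicalSpace G] (f : G → G) (K : Set G) : Set G :=
  {x | x ∈ K ∧ ∀ U : Set G, IsOpen U → x ∈ U →
    ∃ n : ℕ, 0 < n ∧ (f^[n] '' (U ∩ K) ∩ (U ∩ K)).Nonempty}

/-- The almost periodic set `AP(f|K)` of the restriction of `f` to `K`. -/
def almostPeriodicPtsIn {G : Type*} [TopologicalSpace G] (f : G → G) (K : Set G) : Set G :=
  {x | x ∈ K ∧ ∀ U : Set G, IsOpen U → x ∈ U →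
    ∃ m : ℕ, 0 < m ∧ ∀ n : ℕ, ∃ i : ℕ, 1 ≤ i ∧ i ≤ m ∧ f^[n + i] x ∈ U}

/-- The orbit `O(K,f)` of a set `K` under `f`. -/
def setOrbit {G : Type*} (f : G → G) (K : Set G) : Set G := ⋃ i : ℕ, f^[i] '' K

/-- The orbit segment `O_n(K,f)`. -/
def setOrbitSeg {G : Type*} (f : G → G) (K : Set G) (n : ℕ) : Set G :=
  ⋃ i ≤ n, f^[i] '' K

/-- The inverse orbit (absorbed set) `O₋(K,f)`. -/
def invOrbit {G : Type*} (f : G → G) (K : Set G) : Set G := ⋃ i : ℕ, f^[i] ⁻¹' K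

/-- The main absorbed set `Ab(K,f)`: the union of the connected components of `O₋(K,f)`
that meet `K`. -/
def mainAbsorbed {G : Type*} [TopologicalSpace G] (f : G → G) (K : Set G) : Set G :=
  ⋃ x ∈ K, connectedComponentIn (invOrbit f K) x

/-- A minimal set of `f`: nonempty, closed, invariant, with no proper such subset. -/
def IsMinimalSet {G : Type*} [TopologicalSpace G] (f : G → G) (M : Set G) : Prop :=
  M.Nonempty ∧ IsClosed M ∧ f '' M ⊆ M ∧
    ∀ N : Set G, N ⊆ M → N.Nonempty → IsClosed N → f '' N ⊆ N → N = M

open Classical in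
/-- The valence of a point `x` in a metric space: the limit, as `r → 0⁺`, of the number of
boundary points of the ball `B(x,r)` (defined as the eventual value, if it exists). -/
def valence {G : Type*} [MetricSpace G] (x : G) : ℕ :=
  if h : ∃ n : ℕ, ∀ᶠ r in nhdsWithin (0 : ℝ) (Set.Ioi 0),
      (frontier (Metric.ball x r)).ncard = n
  then h.choose else 0

/-- The set of branching points. -/
def branchPts (G : Type*) [MetricSpace G] : Set G := {x | 2 < valence x}

/-- The total branching number `ξ(U)` of a subset `U` of `G`. -/
def totalBranch {G : Type*} [MetricSpace G] (U : Set G) : ℕ :=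
  ∑ᶠ v ∈ U ∩ branchPts G, (valence v - 2)

/-- Cyclic successor on `Fin k`. -/
def finSucc {k : ℕ} (i : Fin k) : Fin k := ⟨(i.1 + 1) % k, Nat.mod_lt _ i.pos⟩

/-- `C : Fin k → Set G` enumerates the connected components of `X`, and `f` maps each
component into the (cyclically) next one. -/
def IsCyclicDecomp {G : Type*} [TopologicalSpace G] (f : G → G) (X : Set G)
    {k : ℕ} (C : Fin k → Set G) : Prop :=
  (⋃ i, C i) = X ∧ (∀ i, (C i).Nonempty) ∧
  (∀ i, ∀ x ∈ C i, connectedComponentIn X x = C i) ∧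
  Function.Injective C ∧ ∀ i, f '' C i ⊆ C (finSucc i)

/-- A component-cyclic `f`-invariant set. -/
def ComponentCyclic {G : Type*} [TopologicalSpace G] (f : G → G) (X : Set G) : Prop :=
  ∃ (k : ℕ) (C : Fin k → Set G), 0 < k ∧ IsCyclicDecomp f X C

/-- `A` is a connected component of `S`. -/
def IsCompOf {G : Type*} [TopologicalSpace G] (A S : Set G) : Prop :=
  ∃ x ∈ S, connectedComponentIn S x = A

/-- The distance between two sets. -/
def setDist {G : Type*} [MetricSpace G] (A B : Set G) : ℝ :=
  sInf {r : ℝ | ∃ a ∈ A, ∃ b ∈ B, dist a b = r}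

end

section Arcs

variable {G : Type*} [TopologicalSpace G] {γ : ℝ → G} {a b : ℝ}

theorem exists_continuousOn_leftInvOn_arc [T2Space G] (hγ : ContinuousOn γ (Icc a b))
    (hinj : InjOn γ (Icc a b)) :
    ∃ π : G → ℝ, ContinuousOn π (γ '' Icc a b) ∧ ∀ t ∈ Icc a b, π (γ t) = t := by
  have hl : ∀ t ∈ Icc a b, invFunOn γ (Icc a b) (γ t) = t := fun t ht =>
    hinj.leftInvOn_invFunOn ht
  refine ⟨invFunOn γ (Icc a b), ?_, hl⟩
  rw [continuousOn_iff_isClosed]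
  intro C hC
  refine ⟨γ '' (Icc a b ∩ C), ?_, ?_⟩
  · exact ((isCompact_Icc.inter_right hC).image_of_continuousOn
      (hγ.mono inter_subset_left)).isClosed
  · ext p
    constructor
    · rintro ⟨hp, t, ht, rfl⟩
      rw [mem_preimage, hl t ht] at hp
      exact ⟨⟨t, ⟨ht, hp⟩, rfl⟩, ⟨t, ht, rfl⟩⟩
    · rintro ⟨⟨t, ⟨ht, htC⟩, rfl⟩, hp⟩
      refine ⟨?_, hp⟩
      rw [mem_preimage, hl t ht]
      exact htC

/-- A path which starts outside an arc and ends in its interior enters the arc for the last time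
through one of the endpoints. -/
theorem exists_last_entry_arc [T2Space G] (hγ : ContinuousOn γ (Icc a b))
    (hopen : IsOpen (γ '' Ioo a b)) {F : G → G} (hF : Continuous F)
    (ha : F (γ a) ∉ γ '' Icc a b) {y : ℝ} (hy : y ∈ Ioo a b) (hFy : F (γ y) ∈ γ '' Ioo a b) :
    ∃ w ∈ Ioo a y, (F (γ w) = γ a ∨ F (γ w) = γ b) ∧
      ∀ t ∈ Icc w y, F (γ t) ∈ γ '' Icc a b := by
  have hsub : Icc a y ⊆ Icc a b := Icc_subset_Icc_right hy.2.le
  have hc : ContinuousOn (fun t => F (γ t)) (Icc a y) := hF.comp_continuousOn (hγ.mono hsub)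
  set S := Icc a y ∩ (fun t => F (γ t)) ⁻¹' (γ '' Ioo a b)ᶜ with hS
  have hScl : IsClosed S := hc.preimage_isClosed_of_isClosed isClosed_Icc hopen.isClosed_compl
  have hScpt : IsCompact S := isCompact_Icc.of_isClosed_subset hScl inter_subset_left
  have haS : a ∈ S := ⟨⟨le_rfl, hy.1.le⟩, fun h => ha (image_mono Ioo_subset_Icc_self h)⟩
  obtain ⟨w, hwS, hw⟩ := hScpt.exists_isGreatest ⟨a, haS⟩
  have hwy : w < y := lt_of_le_of_ne hwS.1.2 (fun h => hwS.2 (by simpa [h] using hFy))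
  have hcl : IsClosed (γ '' Icc a b) := (isCompact_Icc.image_of_continuousOn hγ).isClosed
  have hmem : ∀ t ∈ Icc w y, F (γ t) ∈ γ '' Icc a b := by
    have h1 : IsClosed (Icc w y ∩ (fun t => F (γ t)) ⁻¹' (γ '' Icc a b)) :=
      (hc.mono (Icc_subset_Icc_left hwS.1.1)).preimage_isClosed_of_isClosed isClosed_Icc hcl
    have h2 : Ioc w y ⊆ Icc w y ∩ (fun t => F (γ t)) ⁻¹' (γ '' Icc a b) := by
      intro t ht
      refine ⟨Ioc_subset_Icc_self ht, ?_⟩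
      by_contra hcon
      have : t ∈ S := ⟨⟨hwS.1.1.trans ht.1.le, ht.2⟩,
        fun h => hcon (image_mono Ioo_subset_Icc_self h)⟩
      exact absurd (hw this) (not_le.2 ht.1)
    have h3 := closure_minimal h2 h1
    rw [closure_Ioc hwy.ne] at h3
    exact fun t ht => (h3 ht).2
  have haw : a ≠ w := by
    rintro rfl
    exact ha (hmem a ⟨le_rfl, hwy.le⟩)
  refine ⟨w, ⟨lt_of_le_of_ne hwS.1.1 haw, hwy⟩, ?_, hmem⟩
  obtain ⟨s, hs, hsw⟩ := hmem w ⟨le_rfl, hwy.le⟩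
  rcases eq_endpoints_or_mem_Ioo_of_mem_Icc hs with rfl | rfl | h
  · exact Or.inl hsw.symm
  · exact Or.inr hsw.symm
  · exact absurd ⟨s, h, hsw⟩ hwS.2

end Arcs

section Recurrence

variable {G : Type*} [TopologicalSpace G] {f : G → G}

theorem mem_recurrentPts_iff {x : G} :
    x ∈ recurrentPts f ↔ ∀ U : Set G, IsOpen U → x ∈ U → ∀ i : ℕ, ∃ n ≥ i, f^[n] x ∈ U := by
  simp only [recurrentPts, omegaSet, mem_ofPred_eq, mem_iInter]
  constructor
  · intro h U hU hx i
    obtain ⟨_, hp, n, rfl⟩ := _root_.mem_closure_iff.1 (h i) U hU hx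
    exact ⟨n + i, by omega, hp⟩
  · intro h i
    rw [_root_.mem_closure_iff]
    intro U hU hx
    obtain ⟨n, hn, hnU⟩ := h U hU hx i
    exact ⟨_, hnU, n - i, by simp [Nat.sub_add_cancel hn]⟩

theorem iterate_mem_recurrentPts (hf : Continuous f) {x : G} (hx : x ∈ recurrentPts f) (k : ℕ) :
    f^[k] x ∈ recurrentPts f := by
  rw [mem_recurrentPts_iff] at hx ⊢
  intro U hU hxU i
  obtain ⟨n, hn, h⟩ := hx _ (hU.preimage (hf.iterate k)) hxU i
  refine ⟨n, hn, ?_⟩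
  rwa [← iterate_add_apply, add_comm, iterate_add_apply]

theorem periodicPts_subset_recurrentPts : periodicPts f ⊆ recurrentPts f := by
  rintro x ⟨n, hn, hx⟩
  rw [mem_recurrentPts_iff]
  intro U _ hxU i
  refine ⟨n * i, Nat.le_mul_of_pos_left i hn, ?_⟩
  rw [show f^[n * i] x = x from (hx.mul_const i)]
  exact hxU

theorem almostPeriodicPts_subset_recurrentPts : almostPeriodicPts f ⊆ recurrentPts f := by
  intro x hx
  rw [mem_recurrentPts_iff]
  intro U hU hxU i
  obtain ⟨m, _, h⟩ := hx U hU hxU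
  obtain ⟨j, _, _, hj⟩ := h i
  exact ⟨i + j, by omega, hj⟩

/-- The endpoint of an arc free of periodic points which never returns to the arc is not
accumulated, inside the arc, by recurrent points. -/
theorem notMem_closure_recurrentPts_of_arc [T2Space G] (hf : Continuous f) {γ : ℝ → G} {a b : ℝ}
    (hab : a < b)
    (hγ : ContinuousOn γ (Icc a b)) (hinj : InjOn γ (Icc a b)) (hopen : IsOpen (γ '' Ioo a b))
    (hper : ∀ t ∈ Icc a b, γ t ∉ periodicPts f)
    (ha : ∀ n, 0 < n → f^[n] (γ a) ∉ γ '' Icc a b) :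
    a ∉ closure {t ∈ Ioo a b | γ t ∈ recurrentPts f} := by
  intro hacl
  obtain ⟨π, hπ, hπγ⟩ := exists_continuousOn_leftInvOn_arc hγ hinj
  have hγπ : ∀ p ∈ γ '' Icc a b, γ (π p) = p := by
    rintro _ ⟨t, ht, rfl⟩
    rw [hπγ t ht]
  have hπmem : ∀ p ∈ γ '' Icc a b, π p ∈ Icc a b := by
    rintro _ ⟨t, ht, rfl⟩
    rwa [hπγ t ht]
  have hne : ∀ t ∈ Icc a b, ∀ n, 0 < n → f^[n] (γ t) ≠ γ t :=
    fun t ht n hn h => hper t ht ⟨n, hn, h⟩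
  set R := {t ∈ Ioo a b | γ t ∈ recurrentPts f} with hR
  -- one return
  have hret : ∀ t ∈ R, ∀ u v, a ≤ u → v ≤ b → t ∈ Ioo u v → ∀ i : ℕ, ∃ n ≥ i, ∃ s ∈ R,
      s ∈ Ioo u v ∧ f^[n] (γ t) = γ s := by
    intro t ht u v hu hv htuv i
    have hsub : Ioo u v ⊆ Ioo a b := Ioo_subset_Ioo hu hv
    have hO : IsOpen (γ '' Ioo u v) := by
      have h1 : γ '' Ioo u v = γ '' Ioo a b ∩ (γ '' (Icc a b ∩ (Ioo u v)ᶜ))ᶜ := by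
        ext p
        constructor
        · rintro ⟨s, hs, rfl⟩
          refine ⟨⟨s, hsub hs, rfl⟩, ?_⟩
          rintro ⟨s', hs', hss⟩
          rw [hinj hs'.1 (Ioo_subset_Icc_self (hsub hs)) hss] at hs'
          exact hs'.2 hs
        · rintro ⟨⟨s, hs, rfl⟩, hn⟩
          by_contra hcon
          exact hn ⟨s, ⟨Ioo_subset_Icc_self hs, fun h => hcon ⟨s, h, rfl⟩⟩, rfl⟩
      rw [h1]
      refine hopen.inter (IsClosed.isOpen_compl (self := IsCompact.isClosed ?_))
      exact (isCompact_Icc.inter_right isOpen_Ioo.isClosed_compl).image_of_continuousOn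
        (hγ.mono inter_subset_left)
    obtain ⟨n, hn, s, hs, hsn⟩ := mem_recurrentPts_iff.1 ht.2 _ hO ⟨t, htuv, rfl⟩ i
    refine ⟨n, hn, s, ⟨hsub hs, ?_⟩, hs, hsn.symm⟩
    rw [hsn]
    exact iterate_mem_recurrentPts hf ht.2 n
  -- returns moving to the left and to the right
  have hboth : ∀ t ∈ R, ∀ u v, a ≤ u → v ≤ b → t ∈ Ioo u v →
      (∃ n, 0 < n ∧ ∃ s ∈ R, ∃ s' ∈ R, s ∈ Ioo u v ∧ s' ∈ Ioo u v ∧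
        f^[n] (γ s) = γ s' ∧ s' < s) ∧
      (∃ n, 0 < n ∧ ∃ s ∈ R, ∃ s' ∈ R, s ∈ Ioo u v ∧ s' ∈ Ioo u v ∧
        f^[n] (γ s) = γ s' ∧ s < s') := by
    intro t ht u v hu hv htuv
    obtain ⟨n, hn, s, hsR, hs, hsn⟩ := hret t ht u v hu hv htuv 1
    have hst : s ≠ t := by
      rintro rfl
      exact hne s (Ioo_subset_Icc_self ht.1) n hn hsn
    rcases lt_or_gt_of_ne hst with hlt | hlt
    · refine ⟨⟨n, hn, t, ht, s, hsR, htuv, hs, hsn, hlt⟩, ?_⟩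
      obtain ⟨k, hk, r, hrR, hr, hrk⟩ :=
        hret t ht s v (hu.trans hs.1.le) hv ⟨hlt, htuv.2⟩ (n + 1)
      refine ⟨k - n, by omega, s, hsR, r, hrR, hs, ⟨hs.1.trans hr.1, hr.2⟩, ?_, hr.1⟩
      rw [← hsn, ← iterate_add_apply, Nat.sub_add_cancel (by omega), hrk]
    · refine ⟨?_, ⟨n, hn, t, ht, s, hsR, htuv, hs, hsn, hlt⟩⟩
      obtain ⟨k, hk, r, hrR, hr, hrk⟩ :=
        hret t ht u s hu (hs.2.le.trans hv) ⟨htuv.1, hlt⟩ (n + 1)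
      refine ⟨k - n, by omega, s, hsR, r, hrR, hs, ⟨hr.1, hr.2.trans hs.2⟩, ?_, hr.2⟩
      rw [← hsn, ← iterate_add_apply, Nat.sub_add_cancel (by omega), hrk]
  have hcomp : ∀ (n : ℕ) (u v : ℝ), Icc u v ⊆ Icc a b →
      (∀ t ∈ Icc u v, f^[n] (γ t) ∈ γ '' Icc a b) →
      ContinuousOn (fun t => π (f^[n] (γ t))) (Icc u v) := fun n u v huv h =>
    hπ.comp ((hf.iterate n).comp_continuousOn (hγ.mono huv)) h
  -- a left move
  obtain ⟨t₀, ht₀⟩ : R.Nonempty := closure_nonempty_iff.1 ⟨a, hacl⟩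
  obtain ⟨⟨n, hn, y, hyR, y', hyR', hy, hy', hyn, hlt⟩, -⟩ := hboth t₀ ht₀ a b le_rfl le_rfl ht₀.1
  obtain ⟨w, hw, hwend, hwmem⟩ := exists_last_entry_arc hγ hopen (hf.iterate n) (ha n hn) hy
    ⟨y', hy', hyn.symm⟩
  have hwy : Icc w y ⊆ Icc a b := Icc_subset_Icc hw.1.le hy.2.le
  have hwa : f^[n] (γ w) = γ a := by
    refine hwend.resolve_right fun hwb => ?_
    obtain ⟨t, ht, hfix⟩ := exists_mem_uIcc_isFixedPt (a := w) (b := y)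
      (f := fun t => π (f^[n] (γ t)))
      (by rw [uIcc_of_le hw.2.le]; exact hcomp n w y hwy hwmem)
      (by simp only [hwb, hπγ b ⟨hab.le, le_rfl⟩]; exact (hw.2.trans hy.2).le)
      (by simp only [hyn, hπγ y' (Ioo_subset_Icc_self hy')]; exact hlt.le)
    rw [uIcc_of_le hw.2.le] at ht
    refine hne t (hwy ht) n hn ?_
    have := hγπ _ (hwmem t ht)
    rw [show π (f^[n] (γ t)) = t from hfix] at this
    exact this.symm
  -- a right move close to the endpoint
  have hmin : a < min w y' := lt_min hw.1 hy'.1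
  obtain ⟨t₁, ht₁lt, ht₁⟩ := _root_.mem_closure_iff.1 hacl (Iio (min w y')) isOpen_Iio hmin
  obtain ⟨-, m, hm, s, hsR, s', hsR', hs, hs', hsm, hss⟩ := hboth t₁ ht₁ a (min w y') le_rfl
    ((min_le_left _ _).trans (hw.2.trans hy.2).le) ⟨ht₁.1.1, ht₁lt⟩
  obtain ⟨r, hr, hrend, hrmem⟩ := exists_last_entry_arc hγ hopen (hf.iterate m) (ha m hm) hsR.1
    ⟨s', hsR'.1, hsm.symm⟩
  have hrs : Icc r s ⊆ Icc a b := Icc_subset_Icc hr.1.le hsR.1.2.le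
  have hrb : f^[m] (γ r) = γ b := by
    refine hrend.resolve_left fun hra => ?_
    obtain ⟨t, ht, hfix⟩ := exists_mem_uIcc_isFixedPt (a := s) (b := r)
      (f := fun t => π (f^[m] (γ t)))
      (by rw [uIcc_of_ge hr.2.le]; exact hcomp m r s hrs hrmem)
      (by simp only [hsm, hπγ s' (Ioo_subset_Icc_self hsR'.1)]; exact hss.le)
      (by simp only [hra, hπγ a ⟨le_rfl, hab.le⟩]; exact hr.1.le)
    rw [uIcc_of_ge hr.2.le] at ht
    refine hne t (hrs ht) m hm ?_
    have := hγπ _ (hrmem t ht)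
    rw [show π (f^[m] (γ t)) = t from hfix] at this
    exact this.symm
  -- composing the two moves gives a periodic point
  set c : ℝ → ℝ := fun t => max w (min y (π (f^[m] (γ t)))) with hc
  have hcwy : ∀ t, c t ∈ Icc w y := fun t => ⟨le_max_left _ _, max_le hw.2.le (min_le_left _ _)⟩
  have hccont : ContinuousOn c (Icc r s) :=
    continuousOn_const.sup (continuousOn_const.inf (hcomp m r s hrs hrmem))
  have hcr : c r = y := by
    simp only [hc, hrb, hπγ b ⟨hab.le, le_rfl⟩, min_eq_left hy.2.le, max_eq_right hw.2.le]
  have hs'w : s' < w := hs'.2.trans_le (min_le_left _ _)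
  have hcs : c s = w := by
    simp only [hc, hsm, hπγ s' (Ioo_subset_Icc_self hsR'.1)]
    exact max_eq_left ((min_le_right _ _).trans hs'w.le)
  have hsy' : s < y' := hs.2.trans_le (min_le_right _ _)
  obtain ⟨t, ht, hfix⟩ := exists_mem_uIcc_isFixedPt (a := r) (b := s)
    (f := fun t => π (f^[n] (γ (c t))))
    (by
      rw [uIcc_of_le hr.2.le]
      exact (hcomp n w y hwy hwmem).comp hccont fun t _ => hcwy t)
    (by
      simp only [hcr, hyn, hπγ y' (Ioo_subset_Icc_self hy')]
      exact (hr.2.trans hsy').le)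
    (by simp only [hcs, hwa, hπγ a ⟨le_rfl, hab.le⟩]; exact hs.1.le)
  rw [uIcc_of_le hr.2.le] at ht
  have hfix' : γ t = f^[n] (γ (c t)) := by
    have := hγπ _ (hwmem (c t) (hcwy t))
    rwa [show π (f^[n] (γ (c t))) = t from hfix] at this
  have hq : c t = π (f^[m] (γ t)) := by
    rcases le_total y (π (f^[m] (γ t))) with h1 | h1
    · have : c t = y := by simp only [hc, min_eq_left h1, max_eq_right hw.2.le]
      rw [this, hyn] at hfix'
      have := hinj (hrs ht) (Ioo_subset_Icc_self hy') hfix'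
      exact absurd ht.2 (not_le.2 (this ▸ hsy'))
    · rcases le_total (π (f^[m] (γ t))) w with h2 | h2
      · have : c t = w := by simp only [hc, min_eq_right h1, max_eq_left h2]
        rw [this, hwa] at hfix'
        have := hinj (hrs ht) ⟨le_rfl, hab.le⟩ hfix'
        exact absurd ht.1 (not_le.2 (this ▸ hr.1))
      · simp only [hc, min_eq_right h1, max_eq_right h2]
  refine hne t (hrs ht) (n + m) (by omega) ?_
  rw [hq, hγπ _ (hrmem t ht)] at hfix'
  rw [iterate_add_apply, ← hfix']

end Recurrence
section GraphStructure

variable {G : Type*}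

theorem isCircle_image_Ico [TopologicalSpace G] [T2Space G] {γ : ℝ → G} {p : ℝ} (hp : 0 < p)
    (hγ : ContinuousOn γ (Icc 0 p)) (hinj : InjOn γ (Ico 0 p)) (h : γ 0 = γ p) :
    IsCircle (γ '' Ico 0 p) := by
  have : Fact (0 < p) := ⟨hp⟩
  set F : AddCircle p → G := AddCircle.liftIco p 0 γ with hF
  have hval : ∀ t ∈ Ico (0 : ℝ) p, F (t : AddCircle p) = γ t := fun t ht =>
    AddCircle.liftIco_coe_apply (by simpa using ht)
  have hsurj : ∀ q : AddCircle p, ∃ t ∈ Ico (0 : ℝ) p, (t : AddCircle p) = q := fun q => by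
    have hq : q ∈ (QuotientAddGroup.mk '' Ico (0 : ℝ) (0 + p) : Set (AddCircle p)) := by
      rw [AddCircle.coe_image_Ico_eq]; trivial
    simpa using hq
  have hcont : Continuous F := AddCircle.liftIco_continuous (by simpa using h) (by simpa using hγ)
  have hFinj : Injective F := by
    intro q q' hqq
    obtain ⟨t, ht, rfl⟩ := hsurj q
    obtain ⟨t', ht', rfl⟩ := hsurj q'
    rw [hval t ht, hval t' ht'] at hqq
    rw [hinj ht ht' hqq]
  have hrange : range F = γ '' Ico 0 p := by
    ext q
    constructor
    · rintro ⟨q', rfl⟩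
      obtain ⟨t, ht, rfl⟩ := hsurj q'
      exact ⟨t, ht, (hval t ht).symm⟩
    · rintro ⟨t, ht, rfl⟩
      exact ⟨t, hval t ht⟩
  rw [← hrange]
  exact ⟨(hcont.isClosedEmbedding hFinj).isEmbedding.toHomeomorph.symm.trans
    (AddCircle.homeomorphCircle hp.ne')⟩

theorem isCircle_union_of_arcs [TopologicalSpace G] [T2Space G] {γ₁ γ₂ : ℝ → G}
    (h₁ : ContinuousOn γ₁ (Icc 0 1)) (h₂ : ContinuousOn γ₂ (Icc 0 1))
    (hi₁ : InjOn γ₁ (Icc 0 1)) (hi₂ : InjOn γ₂ (Icc 0 1)) (h0 : γ₁ 0 = γ₂ 0) (h1 : γ₁ 1 = γ₂ 1)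
    (hdisj : Disjoint (γ₁ '' Ioo 0 1) (γ₂ '' Ioo 0 1)) :
    IsCircle (γ₁ '' Icc 0 1 ∪ γ₂ '' Ioo 0 1) := by
  set Γ : ℝ → G := fun t => if t ≤ 1 then γ₁ t else γ₂ (2 - t) with hΓ
  have hΓ₁ : ∀ t, t ≤ 1 → Γ t = γ₁ t := fun t ht => if_pos ht
  have hΓ₂ : ∀ t, 1 < t → Γ t = γ₂ (2 - t) := fun t ht => if_neg (not_le.2 ht)
  have hmixed : ∀ s ∈ Icc (0 : ℝ) 1, ∀ t ∈ Ioo (0 : ℝ) 1, γ₁ s ≠ γ₂ t := by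
    intro s hs t ht hst
    rcases eq_endpoints_or_mem_Ioo_of_mem_Icc hs with rfl | rfl | h
    · rw [h0] at hst
      exact ht.1.ne (hi₂ ⟨le_rfl, zero_le_one⟩ (Ioo_subset_Icc_self ht) hst)
    · rw [h1] at hst
      exact ht.2.ne' (hi₂ ⟨zero_le_one, le_rfl⟩ (Ioo_subset_Icc_self ht) hst)
    · exact disjoint_left.1 hdisj ⟨s, h, rfl⟩ ⟨t, ht, hst.symm⟩
  have himg : Γ '' Ico 0 2 = γ₁ '' Icc 0 1 ∪ γ₂ '' Ioo 0 1 := by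
    ext q
    constructor
    · rintro ⟨t, ht, rfl⟩
      rcases le_or_gt t 1 with h | h
      · exact Or.inl ⟨t, ⟨ht.1, h⟩, (hΓ₁ t h).symm⟩
      · exact Or.inr ⟨2 - t, ⟨by linarith [ht.2], by linarith⟩, (hΓ₂ t h).symm⟩
    · rintro (⟨t, ht, rfl⟩ | ⟨t, ht, rfl⟩)
      · exact ⟨t, ⟨ht.1, by linarith [ht.2]⟩, hΓ₁ t ht.2⟩
      · refine ⟨2 - t, ⟨by linarith [ht.2], by linarith [ht.1]⟩, ?_⟩
        rw [hΓ₂ _ (by linarith [ht.2]), sub_sub_cancel]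
  rw [← himg]
  refine isCircle_image_Ico two_pos ?_ ?_ ?_
  · have hu : Icc (0 : ℝ) 2 = Icc 0 1 ∪ Icc 1 2 := (Icc_union_Icc_eq_Icc (by simp) (by simp)).symm
    rw [hu]
    refine ContinuousOn.union_of_isClosed ?_ ?_ isClosed_Icc isClosed_Icc
    · exact h₁.congr fun t ht => hΓ₁ t ht.2
    · have hc : ContinuousOn (fun t => γ₂ (2 - t)) (Icc 1 2) :=
        h₂.comp (by fun_prop) fun t ht => ⟨by linarith [ht.2], by linarith [ht.1]⟩
      refine hc.congr fun t ht => ?_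
      rcases ht.1.eq_or_lt with rfl | h
      · rw [hΓ₁ 1 le_rfl, h1]; norm_num
      · exact hΓ₂ t h
  · intro s hs t ht hst
    rcases le_or_gt s 1 with h | h <;> rcases le_or_gt t 1 with h' | h'
    · rw [hΓ₁ s h, hΓ₁ t h'] at hst
      exact hi₁ ⟨hs.1, h⟩ ⟨ht.1, h'⟩ hst
    · rw [hΓ₁ s h, hΓ₂ t h'] at hst
      exact absurd hst (hmixed s ⟨hs.1, h⟩ _ ⟨by linarith [ht.2], by linarith⟩)
    · rw [hΓ₂ s h, hΓ₁ t h'] at hst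
      exact absurd hst.symm (hmixed t ⟨ht.1, h'⟩ _ ⟨by linarith [hs.2], by linarith⟩)
    · rw [hΓ₂ s h, hΓ₂ t h'] at hst
      have := hi₂ ⟨by linarith [hs.2], by linarith⟩ ⟨by linarith [ht.2], by linarith⟩ hst
      linarith
  · rw [hΓ₁ 0 zero_le_one, hΓ₂ 2 one_lt_two, h0, sub_self]

/-- An end of an open arc whose closure adds only finitely many points converges. -/
theorem exists_tendsto_arc_end [MetricSpace G] [CompactSpace G] {V C : Set G} (hV : V.Finite)
    (hC : closure C ⊆ C ∪ V) {g : ℝ → G} (hg : ContinuousOn g (Ioo 0 1))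
    (himg : g '' Ioo 0 1 = C) {π : G → ℝ} (hπ : ContinuousOn π C)
    (hπg : ∀ t ∈ Ioo (0 : ℝ) 1, π (g t) = t) :
    ∃ v ∈ V, Tendsto g (𝓝[>] 0) (𝓝 v) := by
  have hIoo : ∀ᶠ t in 𝓝[>] (0 : ℝ), t ∈ Ioo (0 : ℝ) 1 := Ioo_mem_nhdsGT zero_lt_one
  have hclV : ∀ q, MapClusterPt q (𝓝[>] (0 : ℝ)) g → q ∈ V := by
    intro q hq
    rw [mapClusterPt_iff_frequently] at hq
    have hqC : q ∈ closure C := by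
      rw [mem_closure_iff_nhds]
      intro N hN
      obtain ⟨t, htN, ht⟩ := ((hq N hN).and_eventually hIoo).exists
      exact ⟨g t, htN, himg ▸ ⟨t, ht, rfl⟩⟩
    refine (hC hqC).resolve_left fun hqC' => ?_
    obtain ⟨t₀, ht₀, rfl⟩ : q ∈ g '' Ioo 0 1 := himg ▸ hqC'
    have h1 : ∀ᶠ p in 𝓝[C] (g t₀), t₀ / 2 < π p := by
      refine (hπ _ hqC').eventually_const_lt ?_
      rw [hπg t₀ ht₀]
      linarith [ht₀.1]
    have h2 : ∀ᶠ t in 𝓝[>] (0 : ℝ), t ∈ Ioo (0 : ℝ) (t₀ / 2) :=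
      Ioo_mem_nhdsGT (by linarith [ht₀.1])
    obtain ⟨t, ht, ht', ht''⟩ := ((hq _ (eventually_nhdsWithin_iff.1 h1)).and_eventually
      (hIoo.and h2)).exists
    have h3 : t₀ / 2 < π (g t) := ht (himg ▸ ⟨t, ht', rfl⟩)
    rw [hπg t ht'] at h3
    exact absurd ht''.2 (not_lt.2 h3.le)
  obtain ⟨v, -, hv⟩ := isCompact_univ.exists_mapClusterPt_of_frequently
    (l := 𝓝[>] (0 : ℝ)) (f := g) (Frequently.of_forall fun _ => mem_univ _)
  refine ⟨v, hclV v hv, ?_⟩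
  rw [Metric.tendsto_nhds]
  by_contra! hcon
  obtain ⟨ε₀, hε₀, hfar⟩ := hcon
  obtain ⟨ε₁, hε₁, hball⟩ := Metric.isOpen_iff.1
    (hV.subset (sdiff_subset (t := {v}))).isClosed.isOpen_compl v (by simp)
  set ε := min ε₀ (ε₁ / 2) with hε
  have hεpos : 0 < ε := lt_min hε₀ (half_pos hε₁)
  rw [mapClusterPt_iff_frequently] at hv
  have hfreq : ∃ᶠ t in 𝓝[>] (0 : ℝ), g t ∈ sphere v ε := by
    rw [(nhdsGT_basis (0 : ℝ)).frequently_iff]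
    intro δ hδ
    have hI : ∀ᶠ t in 𝓝[>] (0 : ℝ), t ∈ Ioo (0 : ℝ) (min δ 1) :=
      Ioo_mem_nhdsGT (lt_min hδ zero_lt_one)
    obtain ⟨t₁, hd₁, ht₁⟩ := (hfar.and_eventually hI).exists
    obtain ⟨t₂, hd₂, ht₂⟩ := ((hv _ (ball_mem_nhds v hεpos)).and_eventually hI).exists
    have hsub : uIcc t₂ t₁ ⊆ Ioo 0 (min δ 1) := ordConnected_Ioo.uIcc_subset ht₂ ht₁
    have hc : ContinuousOn (fun t => dist (g t) v) (uIcc t₂ t₁) :=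
      (continuous_id.dist continuous_const).comp_continuousOn
        (hg.mono (hsub.trans (Ioo_subset_Ioo_right (min_le_right _ _))))
    obtain ⟨t, ht, hdt⟩ := intermediate_value_uIcc hc
      (Icc_subset_uIcc ⟨(mem_ball.1 hd₂).le, (min_le_left _ _).trans hd₁⟩)
    exact ⟨t, ⟨(hsub ht).1, (hsub ht).2.trans_le (min_le_left _ _)⟩, hdt⟩
  obtain ⟨q, hqs, hq⟩ := (isCompact_sphere v ε).exists_mapClusterPt_of_frequently hfreq
  refine hball (mem_ball.2 ?_) ⟨hclV q hq, ?_⟩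
  · rw [mem_sphere.1 hqs]
    exact (min_le_right _ _).trans_lt (half_lt_self hε₁)
  · rintro rfl
    rw [mem_sphere, dist_self] at hqs
    exact hεpos.ne hqs

theorem exists_path_of_isOpenArc [MetricSpace G] [CompactSpace G] {V C : Set G} (hV : V.Finite)
    (hC : closure C ⊆ C ∪ V) (hne : C.Nonempty) (harc : IsOpenArc C) :
    ∃ γ : ℝ → G, ContinuousOn γ (Icc 0 1) ∧ InjOn γ (Ioo 0 1) ∧ γ '' Ioo 0 1 = C ∧
      γ 0 ∈ V ∧ γ 1 ∈ V := by
  classical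
  obtain ⟨φ⟩ := harc
  obtain ⟨p, hp⟩ := hne
  set g : ℝ → G := fun t => if h : t ∈ Ioo (0 : ℝ) 1 then (φ.symm ⟨t, h⟩ : G) else p with hg
  set π : G → ℝ := fun q => if h : q ∈ C then (φ ⟨q, h⟩ : ℝ) else 0 with hπ
  have hgv : ∀ t (h : t ∈ Ioo (0 : ℝ) 1), g t = φ.symm ⟨t, h⟩ := fun t h => dif_pos h
  have hπv : ∀ q (h : q ∈ C), π q = φ ⟨q, h⟩ := fun q h => dif_pos h
  have hgc : ContinuousOn g (Ioo 0 1) := by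
    rw [continuousOn_iff_continuous_domRestrict]
    refine (continuous_subtype_val.comp φ.symm.continuous).congr fun t => ?_
    simp only [comp_apply, domRestrict_apply, hgv t t.2, Subtype.coe_eta]
  have hπc : ContinuousOn π C := by
    rw [continuousOn_iff_continuous_domRestrict]
    refine (continuous_subtype_val.comp φ.continuous).congr fun t => ?_
    simp only [comp_apply, domRestrict_apply, hπv t t.2, Subtype.coe_eta]
  have himg : g '' Ioo 0 1 = C := by
    ext q
    constructor
    · rintro ⟨t, ht, rfl⟩
      rw [hgv t ht]
      exact (φ.symm _).2
    · intro hq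
      refine ⟨φ ⟨q, hq⟩, (φ ⟨q, hq⟩).2, ?_⟩
      rw [hgv _ (φ ⟨q, hq⟩).2]
      simp
  have hπg : ∀ t ∈ Ioo (0 : ℝ) 1, π (g t) = t := by
    intro t ht
    have : g t ∈ C := himg ▸ ⟨t, ht, rfl⟩
    rw [hπv _ this]
    simp only [hgv t ht, Subtype.coe_eta, Homeomorph.apply_symm_apply]
  obtain ⟨v₀, hv₀, ht₀⟩ := exists_tendsto_arc_end hV hC hgc himg hπc hπg
  have hflip : MapsTo (fun t : ℝ => 1 - t) (Ioo 0 1) (Ioo 0 1) := fun t ht =>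
    ⟨by linarith [ht.2], by linarith [ht.1]⟩
  obtain ⟨v₁, hv₁, ht₁⟩ := exists_tendsto_arc_end (g := fun t => g (1 - t))
    (π := fun q => 1 - π q) hV hC (hgc.comp (by fun_prop) hflip)
    (by
      rw [← himg]
      ext q
      constructor
      · rintro ⟨t, ht, rfl⟩
        exact ⟨1 - t, hflip ht, rfl⟩
      · rintro ⟨t, ht, rfl⟩
        exact ⟨1 - t, hflip ht, by simp⟩)
    (continuousOn_const.sub hπc) (fun t ht => by simp only [hπg _ (hflip ht), sub_sub_cancel])
  have ht₁' : Tendsto g (𝓝[<] 1) (𝓝 v₁) := by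
    have h1 : Tendsto (fun t : ℝ => 1 - t) (𝓝[<] 1) (𝓝[>] 0) := by
      refine tendsto_nhdsWithin_iff.2 ⟨?_, ?_⟩
      · have : Tendsto (fun t : ℝ => 1 - t) (𝓝 1) (𝓝 (1 - 1)) := by
          apply Continuous.tendsto; fun_prop
        rw [sub_self] at this
        exact this.mono_left nhdsWithin_le_nhds
      · filter_upwards [self_mem_nhdsWithin] with t ht
        exact sub_pos.2 (mem_Iio.1 ht)
    simpa [comp_def] using ht₁.comp h1
  have hext : ∀ t ∈ Ioo (0 : ℝ) 1, extendFrom (Ioo 0 1) g t = g t :=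
    extendFrom_extends hgc
  refine ⟨extendFrom (Ioo 0 1) g, continuousOn_Icc_extendFrom_Ioo hgc ht₀ ht₁', ?_, ?_, ?_, ?_⟩
  · intro s hs t ht hst
    rw [hext s hs, hext t ht] at hst
    rw [← hπg s hs, ← hπg t ht, hst]
  · rw [← himg]
    exact image_congr hext
  · rwa [eq_lim_at_left_extendFrom_Ioo zero_lt_one ht₀]
  · rwa [eq_lim_at_right_extendFrom_Ioo zero_lt_one ht₁']

/-- A decomposition of the complement of a finite set `V` into finitely many edges, each of them
parametrized as an arc with endpoints in `V`. -/
structure IsEdgeDecomposition [TopologicalSpace G] (V : Set G) (E : Set (Set G))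
    (γ : Set G → ℝ → G) : Prop where
  finite_vertices : V.Finite
  finite_edges : E.Finite
  continuousOn : ∀ C ∈ E, ContinuousOn (γ C) (Icc 0 1)
  injOn : ∀ C ∈ E, InjOn (γ C) (Icc 0 1)
  image_Ioo : ∀ C ∈ E, γ C '' Ioo 0 1 = C
  left_mem : ∀ C ∈ E, γ C 0 ∈ V
  right_mem : ∀ C ∈ E, γ C 1 ∈ V
  eq_of_mem : ∀ C ∈ E, ∀ D ∈ E, ∀ x ∈ C, x ∈ D → C = D
  disjoint_vertices : ∀ C ∈ E, ∀ x ∈ C, x ∉ V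
  exists_edge : ∀ x ∉ V, ∃ C ∈ E, x ∈ C

theorem IsTopGraph.exists_isEdgeDecomposition [MetricSpace G] {V : Set G} (hG : IsTopGraph V) :
    ∃ E γ, IsEdgeDecomposition V E γ := by
  have := hG.compact
  have hV := hG.finite_vertexSet
  set E : Set (Set G) := {C | IsCompOf C Vᶜ} with hE
  have hsub : ∀ C ∈ E, ∀ x ∈ C, x ∉ V := by
    rintro _ ⟨p, _, rfl⟩ x hx
    exact connectedComponentIn_subset _ _ hx
  have heq : ∀ C ∈ E, ∀ D ∈ E, ∀ x ∈ C, x ∈ D → C = D := by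
    rintro _ ⟨p, _, rfl⟩ _ ⟨q, _, rfl⟩ x hx hx'
    rw [connectedComponentIn_eq hx, connectedComponentIn_eq hx']
  have hpath : ∀ C ∈ E, ∃ γ : ℝ → G, ContinuousOn γ (Icc 0 1) ∧ InjOn γ (Ioo 0 1) ∧
      γ '' Ioo 0 1 = C ∧ γ 0 ∈ V ∧ γ 1 ∈ V := by
    rintro _ ⟨p, hp, rfl⟩
    refine exists_path_of_isOpenArc hV ?_ ⟨p, mem_connectedComponentIn hp⟩
      (hG.component_openArc p hp)
    intro q hq
    by_cases hqV : q ∈ V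
    · exact Or.inr hqV
    · left
      have hpre : IsPreconnected (insert q (connectedComponentIn Vᶜ p)) :=
        isPreconnected_connectedComponentIn.subset_closure (subset_insert _ _)
          (insert_subset hq subset_closure)
      exact hpre.subset_connectedComponentIn (mem_insert_of_mem _ (mem_connectedComponentIn hp))
        (insert_subset hqV (connectedComponentIn_subset _ _)) (mem_insert _ _)
  have := hG.nontrivial.to_nonempty
  choose! γ hγ using hpath
  have hinj : ∀ C ∈ E, InjOn (γ C) (Icc 0 1) := by
    intro C hC
    obtain ⟨hc, hi, himg, h0, h1⟩ := hγ C hC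
    have hnV : ∀ t ∈ Ioo (0 : ℝ) 1, γ C t ∉ V := fun t ht =>
      hsub C hC _ (himg.subset ⟨t, ht, rfl⟩)
    have hico : InjOn (γ C) (Ico 0 1) := by
      intro s hs t ht hst
      rcases hs.1.eq_or_lt with rfl | hs0 <;> rcases ht.1.eq_or_lt with rfl | ht0
      · rfl
      · exact absurd (hst ▸ h0) (hnV t ⟨ht0, ht.2⟩)
      · exact absurd (hst ▸ h0) (hnV s ⟨hs0, hs.2⟩)
      · exact hi ⟨hs0, hs.2⟩ ⟨ht0, ht.2⟩ hst
    have h01 : γ C 0 ≠ γ C 1 := by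
      intro h01
      have h3 := hG.circle_vertices _ (isCircle_image_Ico one_pos hc hico h01)
      have hle : (γ C '' Ico 0 1 ∩ V) ⊆ {γ C 0} := by
        rintro _ ⟨⟨t, ht, rfl⟩, htV⟩
        rcases ht.1.eq_or_lt with rfl | ht0
        · rfl
        · exact absurd htV (hnV t ⟨ht0, ht.2⟩)
      have := ncard_le_ncard hle
      rw [ncard_singleton] at this
      omega
    intro s hs t ht hst
    rcases hs.2.eq_or_lt with rfl | hs1 <;> rcases ht.2.eq_or_lt with rfl | ht1
    · rfl
    · rcases ht.1.eq_or_lt with rfl | ht0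
      · exact absurd hst.symm h01
      · exact absurd (hst ▸ h1) (hnV t ⟨ht0, ht1⟩)
    · rcases hs.1.eq_or_lt with rfl | hs0
      · exact absurd hst h01
      · exact absurd (hst ▸ h1) (hnV s ⟨hs0, hs1⟩)
    · exact hico ⟨hs.1, hs1⟩ ⟨ht.1, ht1⟩ hst
  refine ⟨E, γ, hV, ?_, fun C hC => (hγ C hC).1, hinj, fun C hC => (hγ C hC).2.2.1,
    fun C hC => (hγ C hC).2.2.2.1, fun C hC => (hγ C hC).2.2.2.2, heq, hsub,
    fun x hx => ⟨_, ⟨x, hx, rfl⟩, mem_connectedComponentIn hx⟩⟩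
  refine Set.Finite.of_finite_image (f := fun C => (γ C 0, γ C 1)) ((hV.prod hV).subset ?_) ?_
  · rintro _ ⟨C, hC, rfl⟩
    exact ⟨(hγ C hC).2.2.2.1, (hγ C hC).2.2.2.2⟩
  · intro C hC D hD hCD
    by_contra hne
    obtain ⟨hc, -, himg, -, -⟩ := hγ C hC
    obtain ⟨hd, -, himg', -, -⟩ := hγ D hD
    have hcirc := isCircle_union_of_arcs hc hd (hinj C hC) (hinj D hD) (congrArg Prod.fst hCD)
      (congrArg Prod.snd hCD) (by
        rw [himg, himg', disjoint_left]
        exact fun x hx hx' => hne (heq C hC D hD x hx hx'))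
    have h3 := hG.circle_vertices _ hcirc
    have hle : ((γ C '' Icc 0 1 ∪ γ D '' Ioo 0 1) ∩ V) ⊆ {γ C 0, γ C 1} := by
      rintro x ⟨⟨t, ht, rfl⟩ | hx, hxV⟩
      · rcases eq_endpoints_or_mem_Ioo_of_mem_Icc ht with rfl | rfl | h
        · exact Or.inl rfl
        · exact Or.inr rfl
        · exact absurd hxV (hsub C hC _ (himg.subset ⟨t, h, rfl⟩))
      · exact absurd hxV (hsub D hD _ (himg'.subset hx))
    have := (ncard_le_ncard hle).trans (ncard_insert_le _ _)
    rw [ncard_singleton] at this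
    omega

namespace IsEdgeDecomposition

variable {V : Set G} {E : Set (Set G)} {γ : Set G → ℝ → G}

theorem mem_Ioo_of_notMem [TopologicalSpace G] (h : IsEdgeDecomposition V E γ) {C : Set G}
    (hC : C ∈ E) {t : ℝ} (ht : t ∈ Icc (0 : ℝ) 1) (htV : γ C t ∉ V) : t ∈ Ioo (0 : ℝ) 1 := by
  rcases eq_endpoints_or_mem_Ioo_of_mem_Icc ht with rfl | rfl | h'
  · exact absurd (h.left_mem C hC) htV
  · exact absurd (h.right_mem C hC) htV
  · exact h'

theorem isOpen_image_Ioo [TopologicalSpace G] [T2Space G] (h : IsEdgeDecomposition V E γ)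
    {C : Set G} (hC : C ∈ E) {a b : ℝ} (ha : 0 ≤ a) (hb : b ≤ 1) : IsOpen (γ C '' Ioo a b) := by
  have hK : IsClosed (V ∪ (⋃ D ∈ E \ {C}, γ D '' Icc 0 1) ∪ γ C '' (Icc 0 1 ∩ (Ioo a b)ᶜ)) := by
    refine (h.finite_vertices.isClosed.union ?_).union ?_
    · exact (h.finite_edges.subset sdiff_subset).isClosed_biUnion fun D hD =>
        (isCompact_Icc.image_of_continuousOn (h.continuousOn D hD.1)).isClosed
    · exact ((isCompact_Icc.inter_right isOpen_Ioo.isClosed_compl).image_of_continuousOn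
        ((h.continuousOn C hC).mono inter_subset_left)).isClosed
  convert hK.isOpen_compl using 1
  ext p
  simp only [mem_compl_iff, mem_union, mem_iUnion, not_or]
  constructor
  · rintro ⟨t, ht, rfl⟩
    have ht01 : t ∈ Ioo (0 : ℝ) 1 := Ioo_subset_Ioo ha hb ht
    have htC : γ C t ∈ C := (h.image_Ioo C hC).subset ⟨t, ht01, rfl⟩
    have htV := h.disjoint_vertices C hC _ htC
    refine ⟨⟨htV, ?_⟩, ?_⟩
    · rintro ⟨D, hD, s, hs, hst⟩
      have hs' := h.mem_Ioo_of_notMem hD.1 hs (hst ▸ htV)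
      have hsD : γ C t ∈ D := hst ▸ (h.image_Ioo D hD.1).subset ⟨s, hs', rfl⟩
      exact hD.2 (h.eq_of_mem C hC D hD.1 _ htC hsD).symm
    · rintro ⟨s, hs, hst⟩
      rw [h.injOn C hC hs.1 (Ioo_subset_Icc_self ht01) hst] at hs
      exact hs.2 ht
  · rintro ⟨⟨hpV, hpD⟩, hpC⟩
    obtain ⟨D, hD, hp⟩ := h.exists_edge p hpV
    obtain ⟨t, ht, rfl⟩ := (h.image_Ioo D hD).superset hp
    have hDC : D = C := by
      by_contra hne
      exact hpD ⟨D, ⟨hD, hne⟩, t, Ioo_subset_Icc_self ht, rfl⟩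
    subst hDC
    refine ⟨t, ?_, rfl⟩
    by_contra hcon
    exact hpC ⟨t, ⟨Ioo_subset_Icc_self ht, hcon⟩, rfl⟩

/-- Every point has arbitrarily small neighbourhoods meeting every edge in a subarc. -/
theorem exists_isOpen_ordConnected [MetricSpace G] (h : IsEdgeDecomposition V E γ) {x : G}
    {W : Set G} (hW : IsOpen W) (hx : x ∈ W) :
    ∃ U, IsOpen U ∧ x ∈ U ∧ U ⊆ W ∧ ∀ C ∈ E, OrdConnected {t ∈ Ioo (0 : ℝ) 1 | γ C t ∈ U} := by
  have hS : ∀ C ∈ E, ∃ S : Set ℝ, IsOpen S ∧ OrdConnected S ∧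
      (∀ t ∈ Icc (0 : ℝ) 1, γ C t = x → t ∈ S) ∧ ∀ t ∈ Icc (0 : ℝ) 1, t ∈ S → γ C t ∈ W := by
    intro C hC
    by_cases hex : ∃ t ∈ Icc (0 : ℝ) 1, γ C t = x
    · obtain ⟨t₀, ht₀, rfl⟩ := hex
      have hN := h.continuousOn C hC t₀ ht₀ (hW.mem_nhds hx)
      obtain ⟨δ, hδ, hN⟩ := Metric.mem_nhdsWithin_iff.1 hN
      refine ⟨ball t₀ δ, isOpen_ball, ?_, ?_, fun t ht htS => hN ⟨htS, ht⟩⟩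
      · rw [Real.ball_eq_Ioo]
        exact ordConnected_Ioo
      · intro t ht htt
        rw [h.injOn C hC ht ht₀ htt]
        exact mem_ball_self hδ
    · exact ⟨∅, isOpen_empty, ordConnected_empty, fun t ht htx => (hex ⟨t, ht, htx⟩).elim,
        fun t _ ht => ht.elim⟩
  choose! S hSo hSc hSx hSW using hS
  have hK : IsClosed (V \ {x} ∪ ⋃ C ∈ E, γ C '' (Icc 0 1 ∩ (S C)ᶜ)) := by
    refine (h.finite_vertices.subset sdiff_subset).isClosed.union ?_
    exact h.finite_edges.isClosed_biUnion fun C hC =>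
      ((isCompact_Icc.inter_right (hSo C hC).isClosed_compl).image_of_continuousOn
        ((h.continuousOn C hC).mono inter_subset_left)).isClosed
  refine ⟨_, hK.isOpen_compl, ?_, ?_, ?_⟩
  · simp only [mem_compl_iff, mem_union, mem_iUnion, not_or]
    refine ⟨fun hcon => hcon.2 rfl, ?_⟩
    rintro ⟨C, hC, t, ht, htx⟩
    exact ht.2 (hSx C hC t ht.1 htx)
  · intro p hp
    simp only [mem_compl_iff, mem_union, mem_iUnion, not_or] at hp
    by_cases hpV : p ∈ V
    · have : p = x := by
        by_contra hne
        exact hp.1 ⟨hpV, hne⟩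
      rwa [this]
    · obtain ⟨C, hC, hpC⟩ := h.exists_edge p hpV
      obtain ⟨t, ht, rfl⟩ := (h.image_Ioo C hC).superset hpC
      refine hSW C hC t (Ioo_subset_Icc_self ht) ?_
      by_contra hcon
      exact hp.2 ⟨C, hC, t, ⟨Ioo_subset_Icc_self ht, hcon⟩, rfl⟩
  · intro C hC
    convert ordConnected_Ioo.inter (hSc C hC) using 1
    ext t
    simp only [mem_ofPred_eq, mem_compl_iff, mem_union, mem_iUnion, not_or, mem_inter_iff]
    refine and_congr_right fun ht => ?_
    have htC : γ C t ∈ C := (h.image_Ioo C hC).subset ⟨t, ht, rfl⟩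
    have htV := h.disjoint_vertices C hC _ htC
    constructor
    · intro hp
      by_contra hcon
      exact hp.2 ⟨C, hC, t, ⟨Ioo_subset_Icc_self ht, hcon⟩, rfl⟩
    · intro htS
      refine ⟨fun hcon => htV hcon.1, ?_⟩
      rintro ⟨D, hD, s, hs, hst⟩
      have hs' := h.mem_Ioo_of_notMem hD hs.1 (hst ▸ htV)
      have hsD : γ C t ∈ D := hst ▸ (h.image_Ioo D hD).subset ⟨s, hs', rfl⟩
      obtain rfl := h.eq_of_mem C hC D hD _ htC hsD
      rw [h.injOn C hC hs.1 (Ioo_subset_Icc_self ht) hst] at hs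
      exact hs.2 htS

end IsEdgeDecomposition

end GraphStructure
section Main

variable {G : Type*}

theorem IsEdgeDecomposition.notMem_closure_recurrentPts [TopologicalSpace G] [T2Space G]
    {V : Set G} {E : Set (Set G)} {γ : Set G → ℝ → G} (h : IsEdgeDecomposition V E γ)
    {f : G → G} (hf : Continuous f) {U : Set G} (hU : IsOpen U)
    (hUE : ∀ C ∈ E, OrdConnected {t ∈ Ioo (0 : ℝ) 1 | γ C t ∈ U})
    (hper : Disjoint (closure U) (periodicPts f)) {z : G} (hz : ∀ n, 0 < n → f^[n] z ∉ U) :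
    z ∉ closure (U ∩ recurrentPts f) := by
  intro hzcl
  have hzU : z ∈ closure U := closure_mono inter_subset_left hzcl
  have hzn : z ∉ U ∩ recurrentPts f := by
    rintro ⟨hzU, hzR⟩
    obtain ⟨n, hn, hnU⟩ := mem_recurrentPts_iff.1 hzR U hU hzU 1
    exact hz n hn hnU
  have hside : ∀ (δ : ℝ → G) (a c : ℝ), a < c → ContinuousOn δ (Icc a c) → InjOn δ (Icc a c) →
      IsOpen (δ '' Ioo a c) → δ a = z → (∀ t ∈ Ioc a c, δ t ∈ U) →
      a ∉ closure {t ∈ Ioo a c | δ t ∈ recurrentPts f} := by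
    intro δ a c hac hδ hinj hopen haz hmem
    refine notMem_closure_recurrentPts_of_arc hf hac hδ hinj hopen ?_ ?_
    · intro t ht
      refine disjoint_left.1 hper ?_
      rcases ht.1.eq_or_lt with rfl | hat
      · rwa [haz]
      · exact subset_closure (hmem t ⟨hat, ht.2⟩)
    · rintro n hn ⟨t, ht, htn⟩
      rw [haz] at htn
      rcases ht.1.eq_or_lt with rfl | hat
      · rw [haz] at htn
        exact disjoint_left.1 hper hzU ⟨n, hn, htn.symm⟩
      · exact hz n hn (htn ▸ hmem t ⟨hat, ht.2⟩)
  have hcover : U ∩ recurrentPts f ⊆ (U ∩ recurrentPts f ∩ V) ∪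
      ⋃ C ∈ E, U ∩ recurrentPts f ∩ C := by
    intro p hp
    by_cases hpV : p ∈ V
    · exact Or.inl ⟨hp, hpV⟩
    · obtain ⟨C, hC, hpC⟩ := h.exists_edge p hpV
      exact Or.inr (mem_biUnion hC ⟨hp, hpC⟩)
  have hz1 := closure_mono hcover hzcl
  rw [closure_union, h.finite_edges.closure_biUnion] at hz1
  rcases hz1 with hz1 | hz1
  · rw [(h.finite_vertices.subset inter_subset_right).isClosed.closure_eq] at hz1
    exact hzn hz1.1
  obtain ⟨C, hC, hzC⟩ := mem_iUnion₂.1 hz1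
  have hc := h.continuousOn C hC
  have hi := h.injOn C hC
  set T := {t ∈ Ioo (0 : ℝ) 1 | γ C t ∈ U ∩ recurrentPts f} with hT
  have hTI : closure T ⊆ Icc 0 1 :=
    closure_minimal (fun t ht => Ioo_subset_Icc_self ht.1) isClosed_Icc
  have himg : closure (U ∩ recurrentPts f ∩ C) ⊆ γ C '' closure T := by
    refine closure_minimal ?_ ?_
    · rintro p ⟨hp, hpC⟩
      obtain ⟨t, ht, rfl⟩ := (h.image_Ioo C hC).superset hpC
      exact ⟨t, subset_closure ⟨ht, hp⟩, rfl⟩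
    · exact ((isCompact_Icc.of_isClosed_subset isClosed_closure hTI).image_of_continuousOn
        (hc.mono hTI)).isClosed
  obtain ⟨a, haT, rfl⟩ := himg hzC
  have haI := hTI haT
  have hconn := hUE C hC
  have hbetween : ∀ s ∈ T, ∀ t ∈ T, ∀ r ∈ Icc s t, γ C r ∈ U := fun s hs t ht r hr =>
    (hconn.out ⟨hs.1, hs.2.1⟩ ⟨ht.1, ht.2.1⟩ hr).2
  have hsplit : T ⊆ (T ∩ Ioi a) ∪ (T ∩ Iio a) := by
    intro t ht
    rcases lt_trichotomy a t with hat | rfl | hat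
    · exact Or.inl ⟨ht, hat⟩
    · exact absurd ht.2 hzn
    · exact Or.inr ⟨ht, hat⟩
  have haT' := closure_mono hsplit haT
  rw [closure_union] at haT'
  rcases haT' with haT' | haT'
  · obtain ⟨c, hcT, hac⟩ := closure_nonempty_iff.1 ⟨a, haT'⟩
    rw [mem_Ioi] at hac
    have hsub : Icc a c ⊆ Icc 0 1 := Icc_subset_Icc haI.1 hcT.1.2.le
    refine hside (γ C) a c hac (hc.mono hsub) (hi.mono hsub)
      (h.isOpen_image_Ioo hC haI.1 hcT.1.2.le) rfl ?_ ?_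
    · intro t ht
      obtain ⟨s, hst, hsT, -⟩ := _root_.mem_closure_iff.1 haT' _ isOpen_Iio ht.1
      exact hbetween s hsT c hcT t ⟨hst.le, ht.2⟩
    · rw [_root_.mem_closure_iff]
      intro O hO haO
      obtain ⟨s, ⟨hsO, hsc⟩, hsT, has⟩ :=
        _root_.mem_closure_iff.1 haT' _ (hO.inter isOpen_Iio) ⟨haO, hac⟩
      exact ⟨s, hsO, ⟨has, hsc⟩, hsT.2.2⟩
  · obtain ⟨c, hcT, hac⟩ := closure_nonempty_iff.1 ⟨a, haT'⟩
    rw [mem_Iio] at hac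
    have hsub : Icc c a ⊆ Icc 0 1 := Icc_subset_Icc hcT.1.1.le haI.2
    have hmaps : MapsTo (fun t : ℝ => -t) (Icc (-a) (-c)) (Icc 0 1) := fun t ht =>
      hsub ⟨by linarith [ht.2], by linarith [ht.1]⟩
    refine hside (fun t => γ C (-t)) (-a) (-c) (neg_lt_neg hac)
      (hc.comp (by fun_prop) hmaps)
      (fun s hs t ht hst => neg_injective (hi (hmaps hs) (hmaps ht) hst)) ?_ (by simp) ?_ ?_
    · convert h.isOpen_image_Ioo hC hcT.1.1.le haI.2 using 1
      rw [← image_image (γ C) (fun t => -t)]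
      simp
    · intro t ht
      obtain ⟨s, hst, hsT, -⟩ := _root_.mem_closure_iff.1 haT' _ isOpen_Ioi
        (show -t < a by linarith [ht.1])
      exact hbetween c hcT s hsT (-t) ⟨by linarith [ht.2], (mem_Ioi.1 hst).le⟩
    · rw [_root_.mem_closure_iff]
      intro O hO haO
      obtain ⟨s, ⟨hsO, hsc⟩, hsT, has⟩ := _root_.mem_closure_iff.1 haT' _
        ((hO.preimage continuous_neg).inter isOpen_Ioi) ⟨haO, hac⟩
      refine ⟨-s, hsO, ⟨neg_lt_neg has, neg_lt_neg hsc⟩, ?_⟩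
      simpa using hsT.2.2

/-- If the orbits of recurrent points near `x` stay away from a neighbourhood of `x` for
arbitrarily long times, then some point never returns to that neighbourhood although it is a limit
of recurrent points inside. -/
theorem exists_mem_closure_of_long_gaps [TopologicalSpace G] [CompactSpace G] {f : G → G}
    (hf : Continuous f) {x : G} (hx : x ∈ closure (recurrentPts f)) {U : Set G} (hU : IsOpen U)
    (hxU : x ∈ U) (hgap : ∀ m, ∃ n, ∀ i, 1 ≤ i → i ≤ m → f^[n + i] x ∉ closure U) :
    ∃ z ∈ closure (U ∩ recurrentPts f), ∀ n, 0 < n → f^[n] z ∉ U := by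
  classical
  have hu : ∀ m, ∃ u ∈ U ∩ recurrentPts f, ∀ i, 1 ≤ i → i ≤ m → f^[i] u ∉ U := by
    intro m
    obtain ⟨n, hn⟩ := hgap m
    have hO : IsOpen (U ∩ ⋂ i ∈ Icc 1 m, f^[n + i] ⁻¹' (closure U)ᶜ) :=
      hU.inter ((finite_Icc 1 m).isOpen_biInter fun i _ =>
        isClosed_closure.isOpen_compl.preimage (hf.iterate _))
    obtain ⟨y, ⟨hyU, hy⟩, hyR⟩ := _root_.mem_closure_iff.1 hx _ hO
      ⟨hxU, mem_iInter₂.2 fun i hi => hn i hi.1 hi.2⟩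
    have hy' : ∀ i, 1 ≤ i → i ≤ m → f^[n + i] y ∉ U := fun i h1 h2 hcon =>
      mem_iInter₂.1 hy i ⟨h1, h2⟩ (subset_closure hcon)
    have hkU : f^[Nat.findGreatest (fun k => f^[k] y ∈ U) n] y ∈ U :=
      Nat.findGreatest_spec (P := fun k => f^[k] y ∈ U) (Nat.zero_le n) hyU
    have hkn := Nat.findGreatest_le (P := fun k => f^[k] y ∈ U) n
    set k := Nat.findGreatest (fun k => f^[k] y ∈ U) n with hk
    refine ⟨f^[k] y, ⟨hkU, iterate_mem_recurrentPts hf hyR k⟩, fun i h1 h2 => ?_⟩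
    rw [← iterate_add_apply]
    rcases le_or_gt (i + k) n with hik | hik
    · exact Nat.findGreatest_is_greatest (P := fun k => f^[k] y ∈ U) (by omega) hik
    · have := hy' (i + k - n) (by omega) (by omega)
      rwa [Nat.add_sub_cancel' hik.le] at this
  choose u huU hun using hu
  obtain ⟨z, -, hz⟩ := isCompact_univ.exists_mapClusterPt_of_frequently
    (l := atTop) (f := u) (Frequently.of_forall fun _ => mem_univ _)
  rw [mapClusterPt_iff_frequently] at hz
  refine ⟨z, ?_, fun n hn hcon => ?_⟩
  · rw [mem_closure_iff_nhds]
    intro N hN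
    obtain ⟨m, hm⟩ := (hz N hN).exists
    exact ⟨u m, hm, huU m⟩
  · obtain ⟨m, hm, hnm⟩ := ((hz _ ((hU.preimage (hf.iterate n)).mem_nhds hcon)).and_eventually
      (eventually_ge_atTop n)).exists
    exact hun m n hn hnm hm

end Main

/-- `cl(R(f)) = AP(f) ∪ cl(P(f))` for any graph map `f`. -/
theorem closure_recurrent_eq_ap_union_closure_periodic {G : Type*} [MetricSpace G]
    (V : Set G) (hG : IsTopGraph V) (f : G → G) (hf : Continuous f) :
    closure (recurrentPts f) = almostPeriodicPts f ∪ closure (Function.periodicPts f) := by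
  have := hG.compact
  obtain ⟨E, γ, h⟩ := hG.exists_isEdgeDecomposition
  refine Subset.antisymm ?_ (union_subset
    (almostPeriodicPts_subset_recurrentPts.trans subset_closure)
    (closure_mono periodicPts_subset_recurrentPts))
  intro x hx
  by_contra hcon
  rw [mem_union, not_or] at hcon
  obtain ⟨hxAP, hxP⟩ := hcon
  simp only [almostPeriodicPts, mem_ofPred_eq] at hxAP
  push Not at hxAP
  obtain ⟨W₀, hW₀, hxW₀, hgap⟩ := hxAP
  obtain ⟨K, hKx, hKcl, hKW⟩ := exists_mem_nhds_isClosed_subset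
    ((hW₀.inter isClosed_closure.isOpen_compl).mem_nhds ⟨hxW₀, hxP⟩)
  obtain ⟨U, hU, hxU, hUK, hUE⟩ := h.exists_isOpen_ordConnected isOpen_interior
    (mem_interior_iff_mem_nhds.2 hKx)
  have hUW : closure U ⊆ W₀ ∩ (closure (periodicPts f))ᶜ :=
    (closure_minimal (hUK.trans interior_subset) hKcl).trans hKW
  obtain ⟨z, hz, hzn⟩ := exists_mem_closure_of_long_gaps hf hx hU hxU fun m => by
    obtain ⟨n, hn⟩ := hgap (m + 1) m.succ_pos
    exact ⟨n, fun i h1 h2 hi => hn i h1 (by omega) (hUW hi).1⟩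
  exact h.notMem_closure_recurrentPts hf hU hUE
    (disjoint_left.2 fun p hp hpP => (hUW hp).2 (subset_closure hpP)) hzn hz
end

section
/- Let f : G → G be a graph map with P(f) ≠ ∅ and R(f) − cl(P(f)) ≠ ∅. Then the distance d(R(f) − cl(P(f)), cl(P(f))) = d(cl(R(f)) − cl(P(f)), cl(P(f))) is strictly positive. -/
open Set Function Filter Topology Metric

/-- A parametrization of an edge by `[0, 1]`: a continuous map which restricts to an open
embedding of the open interval `(0, 1)`. -/
structure IsEdgeMap {G : Type*} [TopologicalSpace G] (h : ℝ → G) : Prop where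
  continuous : Continuous h
  injOn : InjOn h (Ioo 0 1)
  isOpen_image : ∀ U ⊆ Ioo (0 : ℝ) 1, IsOpen U → IsOpen (h '' U)

namespace IsEdgeMap

variable {G : Type*} [TopologicalSpace G] {h : ℝ → G}

lemma reflect (hh : IsEdgeMap h) : IsEdgeMap fun t => h (1 - t) where
  continuous := hh.continuous.comp (by fun_prop)
  injOn := by
    intro s hs t ht hst
    have : 1 - s = 1 - t := hh.injOn ⟨by linarith [hs.2], by linarith [hs.1]⟩
      ⟨by linarith [ht.2], by linarith [ht.1]⟩ hst
    linarith
  isOpen_image := by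
    intro U hU hUo
    have : (fun t => h (1 - t)) '' U = h '' ((fun t => 1 - t) ⁻¹' U) := by
      ext y
      constructor
      · rintro ⟨t, ht, rfl⟩
        exact ⟨1 - t, by simpa using ht, rfl⟩
      · rintro ⟨t, ht, rfl⟩
        exact ⟨1 - t, ht, by simp⟩
    rw [this]
    refine hh.isOpen_image _ (fun t ht => ?_) (hUo.preimage (by fun_prop))
    have := hU ht
    exact ⟨by linarith [this.2], by linarith [this.1]⟩

lemma continuousOn_invFunOn (hh : IsEdgeMap h) :
    ContinuousOn (invFunOn h (Ioo 0 1)) (h '' Ioo 0 1) := by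
  rw [_root_.continuousOn_iff']
  intro U hU
  refine ⟨h '' (Ioo 0 1 ∩ U), hh.isOpen_image _ inter_subset_left (isOpen_Ioo.inter hU), ?_⟩
  ext y
  constructor
  · rintro ⟨hyU, t, ht, rfl⟩
    have : invFunOn h (Ioo 0 1) (h t) = t := hh.injOn.leftInvOn_invFunOn ht
    rw [mem_preimage, this] at hyU
    exact ⟨⟨t, ⟨ht, hyU⟩, rfl⟩, ⟨t, ht, rfl⟩⟩
  · rintro ⟨⟨t, ⟨ht, htU⟩, rfl⟩, -⟩
    have : invFunOn h (Ioo 0 1) (h t) = t := hh.injOn.leftInvOn_invFunOn ht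
    exact ⟨by rwa [mem_preimage, this], ⟨t, ht, rfl⟩⟩

/-- A preconnected set meeting an open subarc but not its two end points stays inside it. -/
lemma subset_image_Ioo [T2Space G] (hh : IsEdgeMap h) {α β : ℝ} (hα : 0 ≤ α) (hβ : β ≤ 1)
    {K : Set G} (hK : IsPreconnected K) (hne : (K ∩ h '' Ioo α β).Nonempty)
    (h1 : h α ∉ K) (h2 : h β ∉ K) : K ⊆ h '' Ioo α β := by
  refine hK.subset_left_of_subset_union (v := (h '' Icc α β)ᶜ)
    (hh.isOpen_image _ (Ioo_subset_Ioo hα hβ) isOpen_Ioo)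
    (isCompact_Icc.image hh.continuous).isClosed.isOpen_compl ?_ ?_ hne
  · rw [disjoint_compl_right_iff_subset]
    exact image_mono Ioo_subset_Icc_self
  · intro y hy
    by_cases hy' : y ∈ h '' Icc α β
    · obtain ⟨t, ht, rfl⟩ := hy'
      rcases eq_or_lt_of_le ht.1 with rfl | hlt
      · exact absurd hy h1
      rcases eq_or_lt_of_le ht.2 with rfl | hlt'
      · exact absurd hy h2
      exact Or.inl ⟨t, ⟨hlt, hlt'⟩, rfl⟩
    · exact Or.inr hy'

/-- A preconnected set that meets an open subarc and leaves it contains one of the two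
halves of the subarc. -/
lemma covers_right_or_left [T2Space G] (hh : IsEdgeMap h) {a b p : ℝ} (ha : 0 ≤ a) (hb : b ≤ 1)
    {K : Set G} (hK : IsPreconnected K) (hp : p ∈ Ioo a b) (hpK : h p ∈ K) {y : G}
    (hyK : y ∈ K) (hy : y ∉ h '' Ioo a b) :
    (∀ q ∈ Ico p b, h q ∈ K) ∨ (∀ q ∈ Ioc a p, h q ∈ K) := by
  by_contra! H
  obtain ⟨⟨β, hβ, hβK⟩, ⟨α, hα, hαK⟩⟩ := H
  have hpα : α < p := lt_of_le_of_ne hα.2 (by rintro rfl; exact hαK hpK)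
  have hpβ : p < β := lt_of_le_of_ne hβ.1 (by rintro rfl; exact hβK hpK)
  have := hh.subset_image_Ioo (α := α) (β := β) (by linarith [hα.1]) (by linarith [hβ.2]) hK
    ⟨h p, hpK, p, ⟨hpα, hpβ⟩, rfl⟩ hαK hβK hyK
  exact hy (image_mono (Ioo_subset_Ioo hα.1.le hβ.2.le) this)

/-- If `φ` has no fixed point on a subarc `(a, b)`, moves one of its points to the right and
another one to the left, then `φ` maps some subinterval across any closed subarc `[α, β]` of
the edge on the right of `(a, b)`. -/
lemma exists_crossing_right [T2Space G] (hh : IsEdgeMap h) {φ : G → G} (hφ : Continuous φ)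
    {a b α β u u' v v' : ℝ} (ha : 0 ≤ a) (hbα : b ≤ α) (hαβ : α < β) (hβ : β < 1)
    (hfix : ∀ t ∈ Ioo a b, φ (h t) ≠ h t)
    (hu : u ∈ Ioo a b) (hu' : u' ∈ Ioo a b) (hv : v ∈ Ioo a b) (hv' : v' ∈ Ioo a b)
    (hφu : φ (h u) = h u') (huu' : u < u') (hφv : φ (h v) = h v') (hvv' : v' < v) :
    ∃ c ∈ Ioo a b, ∃ d ∈ Ioo a b, ∃ g : ℝ → ℝ, ContinuousOn g (uIcc c d) ∧ g c = α ∧ g d = β ∧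
      ∀ s ∈ uIcc c d, φ (h s) = h (g s) := by
  have hsub : Ioo a b ⊆ Ioo 0 1 := Ioo_subset_Ioo ha (by linarith)
  have huv : u ≠ v := by
    rintro rfl
    have := hh.injOn (hsub hu') (hsub hv') (hφu.symm.trans hφv)
    linarith
  set γ : ℝ → ℝ := fun τ => u + τ * (v - u) with hγ
  have hγc : Continuous γ := by fun_prop
  have hγ0 : γ 0 = u := by simp [hγ]
  have hγ1 : γ 1 = v := by simp [hγ]
  have hγmem : ∀ τ ∈ Icc (0 : ℝ) 1, γ τ ∈ Ioo a b := by
    intro τ hτ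
    have := (convex_Ioo a b) hu hv (a := 1 - τ) (b := τ) (by linarith [hτ.2]) hτ.1 (by ring)
    convert this using 1
    simp only [hγ, smul_eq_mul]; ring
  set F : ℝ → G := fun τ => φ (h (γ τ)) with hF
  have hFc : Continuous F := hφ.comp (hh.continuous.comp hγc)
  set A : Set ℝ := {τ | τ ∈ Icc (0 : ℝ) 1 ∧ ∃ p, γ τ ≤ p ∧ p ≤ α ∧ F τ = h p} with hA
  have hAc : IsCompact A := by
    have : A = Prod.fst '' ((Icc (0 : ℝ) 1 ×ˢ Icc (0 : ℝ) α) ∩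
        {x : ℝ × ℝ | γ x.1 ≤ x.2 ∧ F x.1 = h x.2}) := by
      ext τ
      constructor
      · rintro ⟨hτ, p, h1, h2, h3⟩
        exact ⟨(τ, p), ⟨⟨hτ, by linarith [(hγmem τ hτ).1], h2⟩, h1, h3⟩, rfl⟩
      · rintro ⟨⟨τ, p⟩, ⟨⟨hτ, hp⟩, h1, h3⟩, rfl⟩
        exact ⟨hτ, p, h1, hp.2, h3⟩
    rw [this]
    refine ((isCompact_Icc.prod isCompact_Icc).inter_right ?_).image continuous_fst
    exact (isClosed_le (hγc.comp continuous_fst) continuous_snd).inter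
      (isClosed_eq (hFc.comp continuous_fst) (hh.continuous.comp continuous_snd))
  have h0A : (0 : ℝ) ∈ A := ⟨by simp, u', by rw [hγ0]; exact huu'.le,
    by linarith [hu'.2], by simp only [hF, hγ0, hφu]⟩
  obtain ⟨τ₀, ⟨hτ₀, p, hp1, hp2, hp3⟩, hmax⟩ := hAc.exists_isGreatest ⟨0, h0A⟩
  have hγτ₀ := hγmem τ₀ hτ₀
  have hp01 : p ∈ Ioo (0 : ℝ) 1 := ⟨by linarith [hγτ₀.1], by linarith⟩
  have hpne : γ τ₀ < p := lt_of_le_of_ne hp1 (by rintro rfl; exact hfix _ hγτ₀ hp3)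
  have hτ₀1 : τ₀ < 1 := by
    refine lt_of_le_of_ne hτ₀.2 ?_
    rintro rfl
    simp only [hF, hγ1, hφv] at hp3
    rw [hγ1] at hpne
    have := hh.injOn (hsub hv') hp01 hp3
    linarith
  set w := (γ τ₀ + p) / 2 with hw
  have hw0 : 0 ≤ w := by linarith [hγτ₀.1]
  have near : ∀ c, p < c → c ≤ 1 → ∃ τ₁ ∈ Ioc τ₀ 1, ∀ τ ∈ Ioc τ₀ τ₁, γ τ < w ∧
      F τ ∈ h '' Ioo w c := by
    intro c hpc hc
    have h1 : ∀ᶠ τ in 𝓝 τ₀, γ τ < w :=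
      hγc.continuousAt.eventually_lt continuousAt_const (by linarith)
    have h2 : ∀ᶠ τ in 𝓝 τ₀, F τ ∈ h '' Ioo w c :=
      hFc.continuousAt.eventually_mem ((hh.isOpen_image _ (Ioo_subset_Ioo hw0 hc)
        isOpen_Ioo).mem_nhds ⟨p, ⟨by linarith, hpc⟩, hp3.symm⟩)
    obtain ⟨ε, hε, hball⟩ := Metric.eventually_nhds_iff.1 (h1.and h2)
    refine ⟨min 1 (τ₀ + ε / 2), ⟨lt_min hτ₀1 (by linarith), min_le_left _ _⟩, fun τ hτ => ?_⟩
    have := hτ.2.trans (min_le_right _ _)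
    refine hball ?_
    rw [Real.dist_eq, abs_of_pos (by linarith [hτ.1])]
    linarith
  have notA : ∀ τ ∈ Ioc τ₀ 1, ∀ q, γ τ ≤ q → F τ = h q → α < q := by
    intro τ hτ q hq hFq
    by_contra! hle
    exact absurd (hmax ⟨⟨by linarith [hτ₀.1, hτ.1], hτ.2⟩, q, hq, hle, hFq⟩) (not_le.2 hτ.1)
  have hpα : p = α := by
    by_contra hne
    have hlt := lt_of_le_of_ne hp2 hne
    obtain ⟨τ₁, hτ₁, H⟩ := near α hlt (by linarith)
    obtain ⟨h1, q, hq, hFq⟩ := H τ₁ ⟨hτ₁.1, le_rfl⟩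
    have := notA τ₁ hτ₁ q (by linarith [hq.1]) hFq.symm
    linarith [hq.2]
  subst hpα
  have inside : ∀ e ∈ Ioc τ₀ 1, (∀ τ ∈ Ioc τ₀ e, F τ ≠ h β) →
      ∀ τ ∈ Ioc τ₀ e, F τ ∈ h '' Ioo p β := by
    intro e he hne τ hτ
    have hK : IsPreconnected (F '' Ioc τ₀ e) := isPreconnected_Ioc.image _ hFc.continuousOn
    refine hh.subset_image_Ioo hp01.1.le hβ.le hK ?_ ?_ ?_ ⟨τ, hτ, rfl⟩
    · obtain ⟨τ₁, hτ₁, H⟩ := near β hαβ hβ.le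
      have hmem : min τ₁ e ∈ Ioc τ₀ τ₁ := ⟨lt_min hτ₁.1 he.1, min_le_left _ _⟩
      obtain ⟨h1, q, hq, hFq⟩ := H _ hmem
      refine ⟨F (min τ₁ e), ⟨_, ⟨hmem.1, min_le_right _ _⟩, rfl⟩, q, ⟨?_, hq.2⟩, hFq⟩
      exact notA _ ⟨hmem.1, hmem.2.trans hτ₁.2⟩ q (by linarith [hq.1]) hFq.symm
    · rintro ⟨σ, hσ, hFσ⟩
      have hσ1 : σ ∈ Ioc τ₀ 1 := ⟨hσ.1, hσ.2.trans he.2⟩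
      have := notA σ hσ1 p (by linarith [(hγmem σ ⟨by linarith [hτ₀.1, hσ.1], hσ1.2⟩).2]) hFσ
      exact lt_irrefl _ this
    · rintro ⟨σ, hσ, hFσ⟩
      exact hne σ hσ hFσ
  have hF1 : F 1 = h v' := by simp only [hF, hγ1, hφv]
  have hBne : ({τ | F τ = h β} ∩ Icc τ₀ 1).Nonempty := by
    by_contra hem
    rw [not_nonempty_iff_eq_empty, eq_empty_iff_forall_notMem] at hem
    obtain ⟨q, hq, hFq⟩ := inside 1 ⟨hτ₀1, le_rfl⟩
      (fun τ hτ hFτ => hem τ ⟨hFτ, hτ.1.le, hτ.2⟩) 1 ⟨hτ₀1, le_rfl⟩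
    have := hh.injOn ⟨by linarith [hq.1, hp01.1], by linarith [hq.2]⟩ (hsub hv') (hFq.trans hF1)
    linarith [hq.1, hv'.2]
  have hBc : IsCompact ({τ | F τ = h β} ∩ Icc τ₀ 1) :=
    isCompact_Icc.inter_left (isClosed_eq hFc continuous_const)
  obtain ⟨δ, ⟨hFδ, hδ⟩, hmin⟩ := hBc.exists_isLeast hBne
  have hβ01 : β ∈ Ioo (0 : ℝ) 1 := ⟨by linarith [hp01.1], hβ⟩
  have hτδ : τ₀ < δ := by
    refine lt_of_le_of_ne hδ.1 ?_
    rintro rfl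
    have := hh.injOn hp01 hβ01 (hp3.symm.trans hFδ)
    linarith
  have himg : ∀ τ ∈ Icc τ₀ δ, F τ ∈ h '' Ioo 0 1 := by
    intro τ hτ
    rcases eq_or_lt_of_le hτ.1 with rfl | h1
    · exact ⟨p, hp01, hp3.symm⟩
    rcases eq_or_lt_of_le hτ.2 with rfl | h2
    · exact ⟨β, hβ01, hFδ.symm⟩
    refine image_mono (Ioo_subset_Ioo hp01.1.le hβ.le) (inside τ ⟨h1, hτ.2.trans hδ.2⟩
      (fun σ hσ hFσ => ?_) τ ⟨h1, le_rfl⟩)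
    have := hmin ⟨hFσ, hσ.1.le, hσ.2.trans (hτ.2.trans hδ.2)⟩
    linarith [hσ.2]
  have hmaps : ∀ s ∈ uIcc (γ τ₀) (γ δ), φ (h s) ∈ h '' Ioo 0 1 := by
    intro s hs
    obtain ⟨τ, hτ, rfl⟩ := intermediate_value_uIcc (hγc.continuousOn) hs
    rw [uIcc_of_le hτδ.le] at hτ
    exact himg τ hτ
  refine ⟨γ τ₀, hγτ₀, γ δ, hγmem δ ⟨by linarith [hτ₀.1], hδ.2⟩,
    fun s => invFunOn h (Ioo 0 1) (φ (h s)), ?_, ?_, ?_, ?_⟩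
  · exact hh.continuousOn_invFunOn.comp (hφ.comp hh.continuous).continuousOn hmaps
  · change invFunOn h (Ioo 0 1) (F τ₀) = p
    rw [hp3]
    exact hh.injOn.leftInvOn_invFunOn hp01
  · change invFunOn h (Ioo 0 1) (F δ) = β
    rw [hFδ]
    exact hh.injOn.leftInvOn_invFunOn hβ01
  · intro s hs
    exact (invFunOn_eq (hmaps s hs)).symm

/-- The analogue of `IsEdgeMap.exists_crossing_right` for subarcs on the left. -/
lemma exists_crossing_left [T2Space G] (hh : IsEdgeMap h) {φ : G → G} (hφ : Continuous φ)
    {a b α β u u' v v' : ℝ} (hα : 0 < α) (hαβ : α < β) (hβa : β ≤ a) (hb : b ≤ 1)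
    (hfix : ∀ t ∈ Ioo a b, φ (h t) ≠ h t)
    (hu : u ∈ Ioo a b) (hu' : u' ∈ Ioo a b) (hv : v ∈ Ioo a b) (hv' : v' ∈ Ioo a b)
    (hφu : φ (h u) = h u') (huu' : u < u') (hφv : φ (h v) = h v') (hvv' : v' < v) :
    ∃ c ∈ Ioo a b, ∃ d ∈ Ioo a b, ∃ g : ℝ → ℝ, ContinuousOn g (uIcc c d) ∧ g c = α ∧ g d = β ∧
      ∀ s ∈ uIcc c d, φ (h s) = h (g s) := by
  have refl_mem : ∀ {t x y : ℝ}, t ∈ Ioo x y → 1 - t ∈ Ioo (1 - y) (1 - x) := fun ht =>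
    ⟨by linarith [ht.2], by linarith [ht.1]⟩
  have refl_mem' : ∀ {t x y : ℝ}, t ∈ Ioo (1 - y) (1 - x) → 1 - t ∈ Ioo x y := fun ht =>
    ⟨by linarith [ht.2], by linarith [ht.1]⟩
  obtain ⟨c, hc, d, hd, g, hg, hgc, hgd, H⟩ := hh.reflect.exists_crossing_right hφ
    (a := 1 - b) (b := 1 - a) (α := 1 - β) (β := 1 - α) (u := 1 - v) (u' := 1 - v')
    (v := 1 - u) (v' := 1 - u') (by linarith) (by linarith) (by linarith) (by linarith)
    (fun t ht => hfix _ (refl_mem' ht)) (refl_mem hv) (refl_mem hv') (refl_mem hu) (refl_mem hu')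
    (by simpa using hφv) (by linarith) (by simpa using hφu) (by linarith)
  have hmem : ∀ s ∈ uIcc (1 - d) (1 - c), 1 - s ∈ uIcc c d := by
    intro s hs
    rw [mem_uIcc] at hs ⊢
    rcases hs with hs | hs
    · exact Or.inl ⟨by linarith, by linarith⟩
    · exact Or.inr ⟨by linarith, by linarith⟩
  refine ⟨1 - d, refl_mem' hd, 1 - c, refl_mem' hc, fun s => 1 - g (1 - s), ?_, by simp [hgd],
    by simp [hgc], fun s hs => ?_⟩
  · exact continuousOn_const.sub (hg.comp (by fun_prop) hmem)
  · simpa using H _ (hmem s hs)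

end IsEdgeMap

/-- Two interval maps crossing each other's domains have a common periodic orbit. -/
lemma exists_mutual_fixedPoint {a₁ b₁ a₂ b₂ c₁ d₁ c₂ d₂ : ℝ} {g₁ g₂ : ℝ → ℝ}
    (hc₁ : c₁ ∈ Ioo a₁ b₁) (hd₁ : d₁ ∈ Ioo a₁ b₁) (hc₂ : c₂ ∈ Ioo a₂ b₂) (hd₂ : d₂ ∈ Ioo a₂ b₂)
    (hg₁ : ContinuousOn g₁ (uIcc c₁ d₁)) (hg₂ : ContinuousOn g₂ (uIcc c₂ d₂))
    (h₁c : g₁ c₁ = a₂) (h₁d : g₁ d₁ = b₂) (h₂c : g₂ c₂ = a₁) (h₂d : g₂ d₂ = b₁) :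
    ∃ s ∈ uIcc c₁ d₁, g₁ s ∈ uIcc c₂ d₂ ∧ g₂ (g₁ s) = s := by
  set κ : ℝ → ℝ := fun y => max (min c₂ d₂) (min (max c₂ d₂) y) with hκ
  have hle : min c₂ d₂ ≤ max c₂ d₂ := min_le_max
  have hκmem : ∀ y, κ y ∈ uIcc c₂ d₂ := fun y =>
    ⟨le_max_left _ _, max_le hle (min_le_left _ _)⟩
  have hκc : Continuous κ := by fun_prop
  have hκid : ∀ y ∈ uIcc c₂ d₂, κ y = y := by
    intro y hy
    have h1 : min c₂ d₂ ≤ y := hy.1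
    have h2 : y ≤ max c₂ d₂ := hy.2
    simp only [hκ, min_eq_right h2, max_eq_right h1]
  have hκlo : ∀ y, y ≤ min c₂ d₂ → κ y = min c₂ d₂ := by
    intro y hy
    simp only [hκ, min_eq_right (hy.trans hle), max_eq_left hy]
  have hκhi : ∀ y, max c₂ d₂ ≤ y → κ y = max c₂ d₂ := by
    intro y hy
    simp only [hκ, min_eq_left hy, max_eq_right hle]
  have hDc : ContinuousOn (fun s => g₂ (κ (g₁ s)) - s) (uIcc c₁ d₁) :=
    ((hg₂.comp_continuous hκc hκmem).comp_continuousOn hg₁).sub continuousOn_id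
  have hca : κ a₂ = min c₂ d₂ := hκlo _ (le_min hc₂.1.le hd₂.1.le)
  have hdb : κ b₂ = max c₂ d₂ := hκhi _ (max_le hc₂.2.le hd₂.2.le)
  have hzero : (0 : ℝ) ∈ uIcc (g₂ (κ (g₁ c₁)) - c₁) (g₂ (κ (g₁ d₁)) - d₁) := by
    rw [h₁c, h₁d, hca, hdb, mem_uIcc]
    rcases le_total c₂ d₂ with hcd | hcd
    · rw [min_eq_left hcd, max_eq_right hcd, h₂c, h₂d]
      exact Or.inl ⟨by linarith [hc₁.1], by linarith [hd₁.2]⟩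
    · rw [min_eq_right hcd, max_eq_left hcd, h₂c, h₂d]
      exact Or.inr ⟨by linarith [hd₁.1], by linarith [hc₁.2]⟩
  obtain ⟨s, hs, hs0⟩ := intermediate_value_uIcc hDc hzero
  have hseq : g₂ (κ (g₁ s)) = s := by simpa [sub_eq_zero] using hs0
  have hsmem : s ∈ Ioo a₁ b₁ :=
    ⟨(lt_min hc₁.1 hd₁.1).trans_le hs.1, hs.2.trans_lt (max_lt hc₁.2 hd₁.2)⟩
  have hends : ∀ y, y = c₂ ∨ y = d₂ → g₂ y ≠ s := by
    rintro y (rfl | rfl)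
    · rw [h₂c]; exact hsmem.1.ne
    · rw [h₂d]; exact hsmem.2.ne'
  have hin : g₁ s ∈ uIcc c₂ d₂ := by
    by_contra hout
    rcases lt_or_ge (g₁ s) (min c₂ d₂) with h1 | h1
    · rw [hκlo _ h1.le] at hseq
      exact hends _ (min_choice c₂ d₂) hseq
    · rcases lt_or_ge (max c₂ d₂) (g₁ s) with h2 | h2
      · rw [hκhi _ h2.le] at hseq
        exact hends _ (max_choice c₂ d₂) hseq
      · exact hout ⟨h1, h2⟩
  exact ⟨s, hs, hin, by rwa [hκid _ hin] at hseq⟩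

/-- Some point of the subarc `h (a, b)` is moved to the right inside this subarc by `f^[n]`. -/
def MovesRight {G : Type*} (f : G → G) (h : ℝ → G) (a b : ℝ) (n : ℕ) : Prop :=
  ∃ t ∈ Ioo a b, ∃ t' ∈ Ioo a b, t < t' ∧ f^[n] (h t) = h t'

/-- Some point of the subarc `h (a, b)` is moved to the left inside this subarc by `f^[n]`. -/
def MovesLeft {G : Type*} (f : G → G) (h : ℝ → G) (a b : ℝ) (n : ℕ) : Prop :=
  ∃ t ∈ Ioo a b, ∃ t' ∈ Ioo a b, t' < t ∧ f^[n] (h t) = h t'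

section Dynamics

variable {G : Type*} [TopologicalSpace G] {f : G → G} {h : ℝ → G}

lemma MovesRight.pos (hh : IsEdgeMap h) {a b : ℝ} (ha : 0 ≤ a) (hb : b ≤ 1) {n : ℕ}
    (H : MovesRight f h a b n) : 0 < n := by
  rcases Nat.eq_zero_or_pos n with rfl | hn
  · obtain ⟨t, ht, t', ht', hlt, heq⟩ := H
    have := hh.injOn (Ioo_subset_Ioo ha hb ht) (Ioo_subset_Ioo ha hb ht') heq
    exact absurd this hlt.ne
  · exact hn

/-- Two disjoint subarcs of an edge without periodic points cannot both contain points moved to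
the right and points moved to the left by one and the same iterate. -/
lemma IsEdgeMap.not_moves_both_of_disjoint [T2Space G] (hh : IsEdgeMap h) (hf : Continuous f)
    {a₁ b₁ a₂ b₂ : ℝ} {n₁ n₂ : ℕ} (ha₁ : 0 < a₁) (hab : b₁ ≤ a₂) (hb₂ : b₂ < 1)
    (hP₁ : ∀ t ∈ Ioo a₁ b₁, h t ∉ periodicPts f) (hP₂ : ∀ t ∈ Ioo a₂ b₂, h t ∉ periodicPts f)
    (hR₁ : MovesRight f h a₁ b₁ n₁) (hL₁ : MovesLeft f h a₁ b₁ n₁)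
    (hR₂ : MovesRight f h a₂ b₂ n₂) (hL₂ : MovesLeft f h a₂ b₂ n₂) : False := by
  have hlt₁ : a₁ < b₁ := by obtain ⟨t, ht, -⟩ := hR₁; exact ht.1.trans ht.2
  have hlt₂ : a₂ < b₂ := by obtain ⟨t, ht, -⟩ := hR₂; exact ht.1.trans ht.2
  have hn₁ := hR₁.pos hh ha₁.le (by linarith)
  have hn₂ := hR₂.pos hh (by linarith) hb₂.le
  obtain ⟨u, hu, u', hu', huu', hfu⟩ := hR₁
  obtain ⟨v, hv, v', hv', hvv', hfv⟩ := hL₁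
  obtain ⟨w, hw, w', hw', hww', hfw⟩ := hR₂
  obtain ⟨z, hz, z', hz', hzz', hfz⟩ := hL₂
  obtain ⟨c₁, hc₁, d₁, hd₁, g₁, hg₁, h₁c, h₁d, H₁⟩ := hh.exists_crossing_right
    (hf.iterate n₁) ha₁.le hab hlt₂ hb₂ (fun t ht hfix => hP₁ t ht ⟨n₁, hn₁, hfix⟩)
    hu hu' hv hv' hfu huu' hfv hvv'
  obtain ⟨c₂, hc₂, d₂, hd₂, g₂, hg₂, h₂c, h₂d, H₂⟩ := hh.exists_crossing_left
    (hf.iterate n₂) ha₁ hlt₁ hab hb₂.le (fun t ht hfix => hP₂ t ht ⟨n₂, hn₂, hfix⟩)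
    hw hw' hz hz' hfw hww' hfz hzz'
  obtain ⟨s, hs, hgs, hfix⟩ :=
    exists_mutual_fixedPoint hc₁ hd₁ hc₂ hd₂ hg₁ hg₂ h₁c h₁d h₂c h₂d
  refine hP₁ s ⟨(lt_min hc₁.1 hd₁.1).trans_le hs.1, hs.2.trans_lt (max_lt hc₁.2 hd₁.2)⟩
    ⟨n₂ + n₁, by omega, ?_⟩
  change f^[n₂ + n₁] (h s) = h s
  rw [iterate_add_apply, H₁ s hs, H₂ _ hgs, hfix]

/-- If the right end point of a subarc never enters the subarc, an iterate that moves no point of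
the subarc to the left covers everything on the right of the image of a point. -/
lemma IsEdgeMap.covers_of_not_movesLeft [T2Space G] (hh : IsEdgeMap h) (hf : Continuous f)
    {a b u v : ℝ} {n : ℕ} (ha : 0 ≤ a) (hb : b ≤ 1) (hend : f^[n] (h b) ∉ h '' Ioo a b)
    (hL : ¬ MovesLeft f h a b n) (hu : u ∈ Ioo a b) (hv : v ∈ Ioo a b) (huv : u < v)
    (hfu : f^[n] (h u) = h v) {q : ℝ} (hq : q ∈ Ico v b) :
    ∃ t ∈ Ico u b, f^[n] (h t) = h q := by
  have hK : IsPreconnected ((fun t => f^[n] (h t)) '' Icc u b) :=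
    isPreconnected_Icc.image _ ((hf.iterate n).comp hh.continuous).continuousOn
  rcases hh.covers_right_or_left ha hb hK hv ⟨u, ⟨le_rfl, hu.2.le⟩, hfu⟩
    ⟨b, ⟨hu.2.le, le_rfl⟩, rfl⟩ hend with H | H
  · obtain ⟨t, ht, hft⟩ := H q hq
    refine ⟨t, ⟨ht.1, lt_of_le_of_ne ht.2 ?_⟩, hft⟩
    rintro rfl
    exact hend ⟨q, ⟨hv.1.trans_le hq.1, hq.2⟩, hft.symm⟩
  · have hm : (a + u) / 2 ∈ Ioo a b := ⟨by linarith [hu.1], by linarith [hu.1, hu.2]⟩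
    obtain ⟨t, ht, hft⟩ := H ((a + u) / 2) ⟨hm.1, by linarith [hu.1]⟩
    have htb : t < b := by
      refine lt_of_le_of_ne ht.2 ?_
      rintro rfl
      exact hend ⟨_, hm, hft.symm⟩
    exact absurd ⟨t, ⟨hu.1.trans_le ht.1, htb⟩, _, hm, by linarith [ht.1, hu.1], hft⟩ hL

lemma mem_recurrentPts_iterate (hf : Continuous f) {x : G} (hx : x ∈ recurrentPts f)
    (i : ℕ) {U : Set G} (hU : IsOpen U) (hxU : f^[i] x ∈ U) (N : ℕ) : ∃ k > N, f^[k] x ∈ U := by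
  have hx' : x ∈ closure (range fun n : ℕ => f^[n + (N + 1)] x) := mem_iInter.1 hx (N + 1)
  obtain ⟨_, hy, ⟨n, rfl⟩⟩ := mem_closure_iff.1 hx' _ (hU.preimage (hf.iterate i)) hxU
  refine ⟨i + (n + (N + 1)), by omega, ?_⟩
  rwa [iterate_add_apply]

lemma iterate_injective_of_recurrent [T1Space G] {x : G} (hx : x ∈ recurrentPts f)
    (hP : x ∉ periodicPts f) : Injective fun n : ℕ => f^[n] x := by
  have key : ∀ i k : ℕ, 0 < k → f^[i + k] x ≠ f^[i] x := by
    intro i k hk heq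
    have hfin : (range fun n : ℕ => f^[n + 1] x).Finite := by
      refine ((finite_Iio (i + k)).image fun n => f^[n + 1] x).subset ?_
      rintro _ ⟨n, rfl⟩
      induction n using Nat.strong_induction_on with
      | _ n ih =>
        by_cases hn : n < i + k
        · exact ⟨n, hn, rfl⟩
        · have : f^[n + 1] x = f^[n - k + 1] x := by
            rw [show n + 1 = (n + 1 - (i + k)) + (i + k) by omega, iterate_add_apply, heq,
              ← iterate_add_apply]
            rw [show n + 1 - (i + k) + i = n - k + 1 by omega]
          simp only [this]
          exact ih (n - k) (by omega)
    have hx1 : x ∈ closure (range fun n : ℕ => f^[n + 1] x) := mem_iInter.1 hx 1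
    rw [hfin.isClosed.closure_eq] at hx1
    obtain ⟨n, hn⟩ := hx1
    exact hP ⟨n + 1, by omega, hn⟩
  intro i j hij
  rcases lt_trichotomy i j with hlt | rfl | hlt
  · obtain ⟨k, rfl⟩ := Nat.exists_eq_add_of_lt hlt
    exact absurd hij.symm (key i (k + 1) (by omega))
  · rfl
  · obtain ⟨k, rfl⟩ := Nat.exists_eq_add_of_lt hlt
    exact absurd hij (key j (k + 1) (by omega))

/-- A recurrent non-periodic point of a subarc provides points `u' < z < u < v` of the subarc
on its orbit such that `u'` and `u` are sent to `v`, and `v` is sent to `z`. -/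
lemma IsEdgeMap.exists_returns [T1Space G] (hh : IsEdgeMap h) (hf : Continuous f) {a b x : ℝ}
    (ha : 0 ≤ a) (hb : b ≤ 1) (hx : x ∈ Ioo a b) (hrec : h x ∈ recurrentPts f)
    (hP : h x ∉ periodicPts f) :
    ∃ u' ∈ Ioo a b, ∃ z ∈ Ioo a b, ∃ u ∈ Ioo a b, ∃ v ∈ Ioo a b, ∃ n' n m : ℕ,
      u' < z ∧ z < u ∧ u < v ∧ 0 < n' ∧ 0 < n ∧ 0 < m ∧
      f^[n'] (h u') = h v ∧ f^[n] (h u) = h v ∧ f^[m] (h v) = h z := by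
  have hopen : ∀ c d : ℝ, a ≤ c → d ≤ b → IsOpen (h '' Ioo c d) := fun c d hc hd =>
    hh.isOpen_image _ (Ioo_subset_Ioo (ha.trans hc) (hd.trans hb)) isOpen_Ioo
  set S : Set ℝ := {t | t ∈ Ioo a b ∧ ∃ k, f^[k] (h x) = h t} with hS
  have hSinf : S.Infinite := by
    intro hfin
    have hT : {k : ℕ | f^[k] (h x) ∈ h '' Ioo a b}.Infinite := by
      rw [Set.infinite_iff_exists_gt]
      intro N
      obtain ⟨k, hk, hkU⟩ := mem_recurrentPts_iterate hf hrec 0 (hopen a b le_rfl le_rfl)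
        ⟨x, hx, rfl⟩ N
      exact ⟨k, hkU, hk⟩
    refine (hT.image (iterate_injective_of_recurrent hrec hP).injOn) ((hfin.image h).subset ?_)
    rintro _ ⟨k, ⟨t, ht, htk⟩, rfl⟩
    exact ⟨t, ⟨ht, k, htk.symm⟩, htk⟩
  obtain ⟨T, hTS, hT4⟩ := hSinf.exists_subset_card_eq 4
  have hmem : ∀ i : Fin 4, T.orderEmbOfFin hT4 i ∈ S := fun i =>
    hTS (T.orderEmbOfFin_mem hT4 i)
  have hlt : ∀ i j : Fin 4, i < j → T.orderEmbOfFin hT4 i < T.orderEmbOfFin hT4 j :=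
    fun i j hij => (T.orderEmbOfFin hT4).strictMono hij
  generalize T.orderEmbOfFin hT4 = p at hmem hlt
  have h01 := hlt 0 1 (by decide)
  have h12 := hlt 1 2 (by decide)
  have h23 := hlt 2 3 (by decide)
  obtain ⟨hp0, k0, hk0⟩ := hmem 0
  obtain ⟨hp1, k1, hk1⟩ := hmem 1
  obtain ⟨hp2, k2, hk2⟩ := hmem 2
  obtain ⟨hp3, k3, hk3⟩ := hmem 3
  obtain ⟨k, hk, v, hv, hkv⟩ := mem_recurrentPts_iterate hf hrec k3
    (hopen (p 2) b hp2.1.le le_rfl) ⟨p 3, ⟨h23, hp3.2⟩, hk3.symm⟩ (max k0 k2)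
  obtain ⟨l, hl, z, hz, hlz⟩ := mem_recurrentPts_iterate hf hrec k1
    (hopen (p 0) (p 2) hp0.1.le hp2.2.le) ⟨p 1, ⟨h01, h12⟩, hk1.symm⟩ k
  have hk0' : k0 < k := lt_of_le_of_lt (le_max_left _ _) hk
  have hk2' : k2 < k := lt_of_le_of_lt (le_max_right _ _) hk
  refine ⟨p 0, hp0, z, ⟨hp0.1.trans hz.1, hz.2.trans hp2.2⟩, p 2, hp2, v,
    ⟨hp2.1.trans hv.1, hv.2⟩, k - k0, k - k2, l - k, hz.1, hz.2, hv.1, by omega, by omega,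
    by omega, ?_, ?_, ?_⟩
  · rw [← hk0, ← iterate_add_apply, Nat.sub_add_cancel hk0'.le, hkv]
  · rw [← hk2, ← iterate_add_apply, Nat.sub_add_cancel hk2'.le, hkv]
  · rw [hkv, ← iterate_add_apply, Nat.sub_add_cancel (le_of_lt hl), hlz]

/-- Let `h (a, b)` be a subarc without periodic points whose right end point is a limit of
periodic points. If it contains a recurrent point, then some iterate of `f` moves points of the
subarc both to the right and to the left. -/
lemma IsEdgeMap.exists_moves_both [T2Space G] (hh : IsEdgeMap h) (hf : Continuous f) {a b x : ℝ}
    (ha : 0 ≤ a) (hb : b ≤ 1) (hx : x ∈ Ioo a b) (hrec : h x ∈ recurrentPts f)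
    (hP : ∀ t ∈ Ioo a b, h t ∉ periodicPts f) (hbP : h b ∈ closure (periodicPts f)) :
    ∃ n, MovesRight f h a b n ∧ MovesLeft f h a b n := by
  by_contra! H
  have hend : ∀ N, f^[N] (h b) ∉ h '' Ioo a b := by
    intro N hN
    have hmaps : MapsTo f^[N] (periodicPts f) (periodicPts f) := by
      rintro y ⟨k, hk, hy⟩
      exact ⟨k, hk, hy.apply_iterate N⟩
    have := map_mem_closure (hf.iterate N) hbP hmaps
    obtain ⟨_, ⟨t, ht, rfl⟩, htP⟩ := mem_closure_iff.1 this _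
      (hh.isOpen_image _ (Ioo_subset_Ioo ha hb) isOpen_Ioo) hN
    exact hP t ht htP
  have hne : ∀ N, 0 < N → ∀ t ∈ Ioo a b, f^[N] (h t) ≠ h t := fun N hN t ht hfix =>
    hP t ht ⟨N, hN, hfix⟩
  obtain ⟨u', hu', z, hz, u, hu, v, hv, n', n, m, hu'z, hzu, huv, hn', hn, hm, hfu', hfu, hfv⟩ :=
    hh.exists_returns hf ha hb hx hrec (hP x hx)
  have hRn' : MovesRight f h a b n' := ⟨u', hu', v, hv, by linarith, hfu'⟩
  have hRn : MovesRight f h a b n := ⟨u, hu, v, hv, huv, hfu⟩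
  have hLm : MovesLeft f h a b m := ⟨v, hv, z, hz, by linarith, hfv⟩
  have hRm : ¬ MovesRight f h a b m := fun h' => H m h' hLm
  have hcm : ∀ q ∈ Ico z b, ∃ t ∈ Ico v b, f^[m] (h t) = h q := by
    have hK : IsPreconnected ((fun t => f^[m] (h t)) '' Icc v b) :=
      isPreconnected_Icc.image _ ((hf.iterate m).comp hh.continuous).continuousOn
    have hlt : ∀ q ∈ Ioo a b, ∀ t ∈ Icc v b, f^[m] (h t) = h q → t < b := by
      intro q hq t ht hft
      refine lt_of_le_of_ne ht.2 ?_
      rintro rfl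
      exact hend m ⟨q, hq, hft.symm⟩
    rcases hh.covers_right_or_left ha hb hK hz ⟨v, ⟨le_rfl, hv.2.le⟩, hfv⟩
      ⟨b, ⟨hv.2.le, le_rfl⟩, rfl⟩ (hend m) with H' | H'
    · intro q hq
      obtain ⟨t, ht, hft⟩ := H' q hq
      exact ⟨t, ⟨ht.1, hlt q ⟨hz.1.trans_le hq.1, hq.2⟩ t ht hft⟩, hft⟩
    · exfalso
      have hq : (a + u') / 2 ∈ Ioo a b := ⟨by linarith [hu'.1], by linarith [hu'.1, hu'.2]⟩
      obtain ⟨t₂, ht₂, hft₂⟩ := H' ((a + u') / 2) ⟨hq.1, by linarith [hu'.1]⟩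
      obtain ⟨t₁, ht₁, hft₁⟩ := hh.covers_of_not_movesLeft hf ha hb (hend n')
        (H n' hRn') hu' hv (by linarith) hfu' ⟨ht₂.1, hlt _ hq _ ht₂ hft₂⟩
      refine H (m + n') ⟨u', hu', z, hz, hu'z, by rw [iterate_add_apply, hfu', hfv]⟩
        ⟨t₁, ⟨hu'.1.trans_le ht₁.1, ht₁.2⟩, _, hq, by linarith [hu'.1, ht₁.1], ?_⟩
      rw [iterate_add_apply, hft₁]
      exact hft₂
  have hRnm : ¬ MovesRight f h a b (m + n) := fun h' =>
    H _ h' ⟨u, hu, z, hz, hzu, by rw [iterate_add_apply, hfu, hfv]⟩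
  have hcn : ∀ c ∈ Ico v b, ∃ d ∈ Ico v b, ∀ q ∈ Ico d b, ∃ t ∈ Ico c b,
      f^[n] (h t) = h q ∧ t < q := by
    intro c hc
    have hcab : c ∈ Ioo a b := ⟨hv.1.trans_le hc.1, hc.2⟩
    have step : ∀ s ∈ Ioo a b, ∀ q ∈ Ioo a b, f^[n] (h s) = h q → s < q := by
      intro s hs q hq hsq
      by_contra! hle
      rcases eq_or_lt_of_le hle with rfl | hlt
      · exact hne n hn _ hs hsq
      · exact H n hRn ⟨s, hs, q, hq, hlt, hsq⟩
    obtain ⟨q, hq, hfq⟩ := hcm c ⟨by linarith [hc.1], hc.2⟩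
    have hqab : q ∈ Ioo a b := ⟨hv.1.trans_le hq.1, hq.2⟩
    obtain ⟨t, ht, hft⟩ := hh.covers_of_not_movesLeft hf ha hb (hend n) (H n hRn) hu hv huv hfu hq
    have htab : t ∈ Ioo a b := ⟨hu.1.trans_le ht.1, ht.2⟩
    have hct : c ≤ t := by
      by_contra! hlt
      exact hRnm ⟨t, htab, c, hcab, hlt, by rw [iterate_add_apply, hft, hfq]⟩
    refine ⟨q, hq, fun q₂ hq₂ => ?_⟩
    obtain ⟨t₂, ht₂, hft₂⟩ := hh.covers_of_not_movesLeft hf ha hb (hend n) (H n hRn) htab hqab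
      (step t htab q hqab hft) hft hq₂
    exact ⟨t₂, ⟨hct.trans ht₂.1, ht₂.2⟩, hft₂, step t₂ ⟨htab.1.trans_le ht₂.1, ht₂.2⟩ q₂
      ⟨hqab.1.trans_le hq₂.1, hq₂.2⟩ hft₂⟩
  have hcnk : ∀ k : ℕ, ∀ c ∈ Ico v b, ∃ d ∈ Ico v b, ∀ q ∈ Ico d b, ∃ t ∈ Ico c b,
      f^[n * (k + 1)] (h t) = h q ∧ t < q := by
    intro k
    induction k with
    | zero => simpa using hcn
    | succ k ih =>
      intro c hc
      obtain ⟨d, hd, Hd⟩ := hcn c hc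
      obtain ⟨e, he, He⟩ := ih d hd
      refine ⟨e, he, fun q hq => ?_⟩
      obtain ⟨s, hs, hfs, hsq⟩ := He q hq
      obtain ⟨t, ht, hft, hts⟩ := Hd s hs
      refine ⟨t, ht, ?_, hts.trans hsq⟩
      rw [Nat.mul_succ, iterate_add_apply, hft, hfs]
  have hcmk : ∀ k : ℕ, ∀ q ∈ Ico v b, ∃ t ∈ Ico v b, f^[m * (k + 1)] (h t) = h q ∧ q < t := by
    have one : ∀ q ∈ Ico v b, ∃ t ∈ Ico v b, f^[m] (h t) = h q ∧ q < t := by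
      intro q hq
      obtain ⟨t, ht, hft⟩ := hcm q ⟨by linarith [hq.1], hq.2⟩
      have htab : t ∈ Ioo a b := ⟨hv.1.trans_le ht.1, ht.2⟩
      refine ⟨t, ht, hft, ?_⟩
      by_contra! hle
      rcases eq_or_lt_of_le hle with rfl | hlt
      · exact hne m hm _ htab hft
      · exact hRm ⟨t, htab, q, ⟨hv.1.trans_le hq.1, hq.2⟩, hlt, hft⟩
    intro k
    induction k with
    | zero => simpa using one
    | succ k ih =>
      intro q hq
      obtain ⟨s, hs, hfs, hqs⟩ := ih q hq
      obtain ⟨t, ht, hft, hst⟩ := one s hs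
      refine ⟨t, ht, ?_, hqs.trans hst⟩
      rw [Nat.mul_succ, iterate_add_apply, hft, hfs]
  obtain ⟨m', rfl⟩ : ∃ m', m = m' + 1 := ⟨m - 1, by omega⟩
  obtain ⟨n₀, rfl⟩ : ∃ n₀, n = n₀ + 1 := ⟨n - 1, by omega⟩
  have hIoo : ∀ {t}, t ∈ Ico v b → t ∈ Ioo a b := fun ht => ⟨hv.1.trans_le ht.1, ht.2⟩
  obtain ⟨d, hd, Hd⟩ := hcnk m' v ⟨le_rfl, hv.2⟩
  obtain ⟨t, ht, hft, htd⟩ := Hd d ⟨le_rfl, hd.2⟩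
  obtain ⟨s, hs, hfs, hds⟩ := hcmk n₀ d hd
  refine H ((n₀ + 1) * (m' + 1)) ⟨t, hIoo ht, d, hIoo hd, htd, hft⟩
    ⟨s, hIoo hs, d, hIoo hd, hds, ?_⟩
  rw [mul_comm, hfs]

lemma IsEdgeMap.exists_subarc_moves_both [T2Space G] (hh : IsEdgeMap h) (hf : Continuous f)
    {c s x : ℝ} (hc : 0 ≤ c) (hs : s ≤ 1) (hx : x ∈ Ioo c s) (hrec : h x ∈ recurrentPts f)
    (hxP : h x ∉ closure (periodicPts f)) (hsP : h s ∈ closure (periodicPts f)) :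
    ∃ α β, c < α ∧ β < s ∧ (∀ t ∈ Ioo α β, h t ∉ periodicPts f) ∧
      ∃ n, MovesRight f h α β n ∧ MovesLeft f h α β n := by
  have hcl : IsClosed (h ⁻¹' closure (periodicPts f)) := isClosed_closure.preimage hh.continuous
  obtain ⟨b, ⟨hbP, hb⟩, hmin⟩ := (isCompact_Icc.inter_left hcl).exists_isLeast
    ⟨s, hsP, hx.2.le, le_rfl⟩
  have hxb : x < b := lt_of_le_of_ne hb.1 (by rintro rfl; exact hxP hbP)
  obtain ⟨ε, hε, hball⟩ := Metric.isOpen_iff.1 hcl.isOpen_compl x hxP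
  set a := max c (x - ε) with ha
  have hax : a < x := max_lt hx.1 (by linarith)
  have hP : ∀ t ∈ Ioo a b, h t ∉ periodicPts f := by
    intro t ht htP
    rcases lt_or_ge t x with h1 | h1
    · refine hball (a := t) ?_ (subset_closure htP)
      rw [Metric.mem_ball, Real.dist_eq, abs_sub_comm, abs_of_pos (by linarith)]
      linarith [ht.1, le_max_right c (x - ε)]
    · have := hmin ⟨subset_closure htP, h1, ht.2.le.trans hb.2⟩
      linarith [ht.2]
  have hca : c ≤ a := le_max_left _ _
  obtain ⟨n, ⟨u, hu, u', hu', huu', hfu⟩, ⟨v, hv, v', hv', hvv', hfv⟩⟩ :=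
    hh.exists_moves_both hf (hc.trans hca) (hb.2.trans hs) ⟨hax, hxb⟩ hrec hP hbP
  obtain ⟨α, haα, hα⟩ := exists_between (lt_min hu.1 hv'.1)
  obtain ⟨β, hβ, hβb⟩ := exists_between (max_lt hu'.2 hv.2)
  rw [lt_min_iff] at hα
  rw [max_lt_iff] at hβ
  refine ⟨α, β, hca.trans_lt haα, hβb.trans_le hb.2,
    fun t ht => hP t ⟨haα.trans ht.1, ht.2.trans hβb⟩, n, ?_, ?_⟩
  · exact ⟨u, ⟨hα.1, huu'.trans hβ.1⟩, u', ⟨hα.1.trans huu', hβ.1⟩, huu', hfu⟩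
  · exact ⟨v, ⟨hα.2.trans hvv', hβ.2⟩, v', ⟨hα.2, hvv'.trans hβ.2⟩, hvv', hfv⟩

/-- Recurrent points outside the closure of the periodic points cannot accumulate from the left
along an edge at a point of this closure. -/
lemma IsEdgeMap.not_accumulate_left [T2Space G] (hh : IsEdgeMap h) (hf : Continuous f) {s : ℝ}
    (hs : s ≤ 1) (hsP : h s ∈ closure (periodicPts f))
    (hacc : ∀ c < s, ∃ t ∈ Ioo c s, 0 < t ∧ h t ∈ recurrentPts f \ closure (periodicPts f)) :
    False := by
  obtain ⟨x, hx, hx0, hxR, hxP⟩ := hacc (s - 1) (by linarith)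
  obtain ⟨α₁, β₁, hα₁, hβ₁, hP₁, n₁, hR₁, hL₁⟩ :=
    hh.exists_subarc_moves_both hf le_rfl hs ⟨hx0, hx.2⟩ hxR hxP hsP
  have hlt : α₁ < β₁ := by obtain ⟨t, ht, -⟩ := hR₁; exact ht.1.trans ht.2
  obtain ⟨y, hy, hy0, hyR, hyP⟩ := hacc β₁ hβ₁
  obtain ⟨α₂, β₂, hα₂, hβ₂, hP₂, n₂, hR₂, hL₂⟩ :=
    hh.exists_subarc_moves_both hf (by linarith) hs hy hyR hyP hsP
  exact hh.not_moves_both_of_disjoint hf hα₁ hα₂.le (by linarith) hP₁ hP₂ hR₁ hL₁ hR₂ hL₂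

/-- The closure of the recurrent points of an open edge that lie outside the closure of the
periodic points is disjoint from the latter. -/
lemma IsEdgeMap.disjoint_closure [T2Space G] (hh : IsEdgeMap h) (hf : Continuous f) :
    Disjoint (closure ((recurrentPts f \ closure (periodicPts f)) ∩ h '' Ioo 0 1))
      (closure (periodicPts f)) := by
  rw [Set.disjoint_left]
  intro y hy hyP
  set T : Set ℝ := {t | t ∈ Ioo 0 1 ∧ h t ∈ recurrentPts f \ closure (periodicPts f)} with hT
  have hTI : closure T ⊆ Icc 0 1 :=
    closure_minimal (fun t ht => Ioo_subset_Icc_self ht.1) isClosed_Icc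
  have hTc : IsCompact (closure T) := isCompact_Icc.of_isClosed_subset isClosed_closure hTI
  have hsub : (recurrentPts f \ closure (periodicPts f)) ∩ h '' Ioo 0 1 ⊆ h '' closure T := by
    rintro _ ⟨hR, t, ht, rfl⟩
    exact ⟨t, subset_closure ⟨ht, hR⟩, rfl⟩
  obtain ⟨s, hs, rfl⟩ := closure_minimal hsub (hTc.image hh.continuous).isClosed hy
  have hs01 := hTI hs
  have hTs : ∀ t ∈ T, t ≠ s := by
    rintro t ht rfl
    exact ht.2.2 hyP
  have hacc : ∀ ε > 0, ∃ t ∈ T, |t - s| < ε := by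
    intro ε hε
    obtain ⟨t, ht, hd⟩ := Metric.mem_closure_iff.1 hs ε hε
    exact ⟨t, ht, by rwa [dist_comm, Real.dist_eq] at hd⟩
  by_cases hleft : ∀ c < s, ∃ t ∈ T, t ∈ Ioo c s
  · refine hh.not_accumulate_left hf hs01.2 hyP fun c hc => ?_
    obtain ⟨t, ht, htc⟩ := hleft c hc
    exact ⟨t, htc, ht.1.1, ht.2⟩
  · push Not at hleft
    obtain ⟨c, hc, hcT⟩ := hleft
    refine hh.reflect.not_accumulate_left hf (s := 1 - s) (by linarith [hs01.1])
      (by simpa using hyP) fun d hd => ?_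
    obtain ⟨t, ht, htd⟩ := hacc (min (s - c) (1 - s - d)) (lt_min (by linarith) (by linarith))
    rw [lt_min_iff, abs_lt, abs_lt] at htd
    have hst : s < t := by
      by_contra! hle
      exact hcT t ht ⟨by linarith [htd.1.1], lt_of_le_of_ne hle (hTs t ht)⟩
    exact ⟨1 - t, ⟨by linarith [htd.2.2], by linarith⟩, by linarith [ht.1.2], by simpa using ht.2⟩

end Dynamics

section GraphStructure

variable {G : Type*}

/-- A closed curve which is injective apart from its end points traces out a circle. -/
lemma isCircle_image [TopologicalSpace G] [T2Space G] {k : ℝ → G} (hk : ContinuousOn k (Icc 0 1))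
    (h01 : k 0 = k 1) (hinj : InjOn k (Ico 0 1)) : IsCircle (k '' Ico 0 1) := by
  have : Fact ((0 : ℝ) < 1) := ⟨one_pos⟩
  set F : AddCircle (1 : ℝ) → G := AddCircle.liftIco 1 0 k with hF
  have hFc : Continuous F := by
    refine AddCircle.liftIco_continuous (by simpa using h01) (by simpa using hk)
  have hFk : ∀ t ∈ Ico (0 : ℝ) 1, F (t : AddCircle (1 : ℝ)) = k t := fun t ht =>
    AddCircle.liftIco_coe_apply (by simpa using ht)
  have hrep : ∀ z : AddCircle (1 : ℝ), ∃ t ∈ Ico (0 : ℝ) 1, (t : AddCircle (1 : ℝ)) = z := by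
    intro z
    have hz : z ∈ ((↑) : ℝ → AddCircle (1 : ℝ)) '' Ico 0 (0 + 1) := by
      rw [AddCircle.coe_image_Ico_eq]; trivial
    obtain ⟨t, ht, rfl⟩ := hz
    exact ⟨t, by simpa using ht, rfl⟩
  have hFinj : Injective F := by
    intro z w hzw
    obtain ⟨s, hs, rfl⟩ := hrep z
    obtain ⟨t, ht, rfl⟩ := hrep w
    rw [hFk s hs, hFk t ht] at hzw
    rw [hinj hs ht hzw]
  have hrange : range F = k '' Ico 0 1 := by
    ext y
    constructor
    · rintro ⟨z, rfl⟩
      obtain ⟨t, ht, rfl⟩ := hrep z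
      exact ⟨t, ht, (hFk t ht).symm⟩
    · rintro ⟨t, ht, rfl⟩
      exact ⟨t, hFk t ht⟩
  have hemb : IsEmbedding F := (hFc.isClosedEmbedding hFinj).isEmbedding
  rw [← hrange]
  have e1 : AddCircle (1 : ℝ) ≃ₜ range F := hemb.toHomeomorph
  have e2 : AddCircle (1 : ℝ) ≃ₜ Circle := AddCircle.homeomorphCircle one_ne_zero
  have e3 : Circle ≃ₜ Metric.sphere (0 : ℂ) 1 := Homeomorph.refl _
  exact ⟨e1.symm.trans (e2.trans e3)⟩

/-- A curve in a compact space that leaves every compact set disjoint from a finite set `V`,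
along a filter generated by preconnected sets, converges to a point of `V`. -/
lemma exists_tendsto_of_finite [TopologicalSpace G] [T2Space G] [CompactSpace G] {V : Set G}
    (hV : V.Finite) {g : ℝ → G} {l : Filter ℝ} [l.NeBot]
    (hl : ∀ S ∈ l, ∃ S' ∈ l, S' ⊆ S ∧ IsPreconnected (g '' S'))
    (hg : ∀ p ∉ V, Disjoint (𝓝 p) (map g l)) : ∃ v ∈ V, Tendsto g l (𝓝 v) := by
  have hW : ∀ W : Set G, IsOpen W → V ⊆ W → ∀ᶠ t in l, g t ∈ W := by
    intro W hWo hVW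
    have h1 : Disjoint (𝓝ˢ Wᶜ) (map g l) :=
      hWo.isClosed_compl.isCompact.disjoint_nhdsSet_left.2 fun p hp => hg p fun hpV => hp (hVW hpV)
    have h2 : Disjoint (𝓟 Wᶜ) (map g l) := h1.mono_left principal_le_nhdsSet
    rw [disjoint_comm, disjoint_principal_right, compl_compl] at h2
    exact h2
  obtain ⟨v, hv⟩ := exists_clusterPt_of_compactSpace (map g l)
  have hvV : v ∈ V := by
    by_contra hvV
    exact hv.ne (disjoint_iff.1 (hg v hvV))
  refine ⟨v, hvV, ?_⟩
  rw [_root_.tendsto_nhds]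
  intro U hU hvU
  obtain ⟨O, O', hO, hO', hvO, hVO', hdisj⟩ :=
    SeparatedNhds.of_isCompact_isCompact (s := {v}) (t := V \ {v}) isCompact_singleton
      hV.sdiff.isCompact disjoint_sdiff_right
  have hev := hW ((O ∩ U) ∪ O') ((hO.inter hU).union hO') fun y hy => by
    by_cases hyv : y = v
    · subst hyv
      exact Or.inl ⟨hvO rfl, hvU⟩
    · exact Or.inr (hVO' ⟨hy, hyv⟩)
  obtain ⟨S', hS', hS'sub, hconn⟩ := hl _ hev
  have hfreq : ∃ᶠ t in l, g t ∈ O ∩ U := by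
    have := (clusterPt_iff_frequently.1 hv) (O ∩ U) ((hO.inter hU).mem_nhds ⟨hvO rfl, hvU⟩)
    exact this
  obtain ⟨t, htOU, htS'⟩ := (hfreq.and_eventually hS').exists
  have hsub := hconn.subset_left_of_subset_union (hO.inter hU) hO'
    (hdisj.mono_left inter_subset_left) (image_subset_iff.2 hS'sub) ⟨g t, ⟨t, htS', rfl⟩, htOU⟩
  filter_upwards [hS'] with t ht
  exact (hsub ⟨t, ht, rfl⟩).2

variable [MetricSpace G] {V : Set G}

lemma closure_connectedComponentIn_compl_subset (x : G) (hx : x ∈ Vᶜ) :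
    closure (connectedComponentIn Vᶜ x) ⊆ connectedComponentIn Vᶜ x ∪ V := by
  intro p hp
  by_cases hpV : p ∈ V
  · exact Or.inr hpV
  · left
    have hpre : IsPreconnected (insert p (connectedComponentIn Vᶜ x)) :=
      isPreconnected_connectedComponentIn.subset_closure (subset_insert _ _)
        (insert_subset hp subset_closure)
    exact hpre.subset_connectedComponentIn (mem_insert_of_mem _ (mem_connectedComponentIn hx))
      (insert_subset hpV (connectedComponentIn_subset _ _)) (mem_insert _ _)

/-- A curve joining two points of `V` whose interior is simple and avoids `V`. -/
structure IsEdgeParam (V : Set G) (h : ℝ → G) : Prop where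
  continuous : Continuous h
  zero_mem : h 0 ∈ V
  one_mem : h 1 ∈ V
  injOn : InjOn h (Ioo 0 1)
  notMem : ∀ t ∈ Ioo (0 : ℝ) 1, h t ∉ V

/-- Every component of the complement of the vertex set is the interior of a parametrized curve
between two vertices. -/
lemma IsTopGraph.exists_param (hG : IsTopGraph V) {x : G} (hx : x ∈ Vᶜ) :
    ∃ h : ℝ → G, IsEdgeParam V h ∧ h '' Ioo 0 1 = connectedComponentIn Vᶜ x := by
  have := hG.compact
  obtain ⟨e⟩ := hG.component_openArc x hx
  set C := connectedComponentIn Vᶜ x with hC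
  classical
  set g : ℝ → G := fun t => if ht : t ∈ Ioo (0 : ℝ) 1 then (e.symm ⟨t, ht⟩ : G) else x with hg
  have hgt : ∀ t (ht : t ∈ Ioo (0 : ℝ) 1), g t = e.symm ⟨t, ht⟩ := fun t ht => by
    simp only [hg, dif_pos ht]
  have hgcont : ContinuousOn g (Ioo 0 1) := by
    rw [continuousOn_iff_continuous_domRestrict]
    have : (Ioo (0 : ℝ) 1).domRestrict g = fun t => (e.symm t : G) := by
      funext t
      exact hgt t t.2
    rw [this]
    exact continuous_subtype_val.comp e.symm.continuous
  have hgmem : ∀ t ∈ Ioo (0 : ℝ) 1, g t ∈ C := fun t ht => by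
    rw [hgt t ht]; exact (e.symm _).2
  have hginj : InjOn g (Ioo 0 1) := by
    intro s hs t ht hst
    rw [hgt s hs, hgt t ht] at hst
    simpa using e.symm.injective (Subtype.ext hst)
  have hgimg : g '' Ioo 0 1 = C := by
    ext y
    constructor
    · rintro ⟨t, ht, rfl⟩
      exact hgmem t ht
    · intro hy
      exact ⟨e ⟨y, hy⟩, (e ⟨y, hy⟩).2, by rw [hgt _ (e ⟨y, hy⟩).2]; simp⟩
  have hlim : ∀ l : Filter ℝ, l.NeBot → Ioo (0 : ℝ) 1 ∈ l →
      (∀ s ∈ Ioo (0 : ℝ) 1, Disjoint (𝓝 s) l) →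
      (∀ S ∈ l, ∃ S' ∈ l, S' ⊆ S ∧ S' ⊆ Ioo 0 1 ∧ IsPreconnected S') →
      ∃ v ∈ V, Tendsto g l (𝓝 v) := by
    intro l hne hmem hdisj hpre
    refine exists_tendsto_of_finite hG.finite_vertexSet ?_ ?_
    · intro S hS
      obtain ⟨S', hS', h1, h2, h3⟩ := hpre S hS
      exact ⟨S', hS', h1, h3.image _ (hgcont.mono h2)⟩
    · intro p hpV
      rw [Filter.disjoint_iff]
      by_cases hpC : p ∈ C
      · obtain ⟨A, hA, B, hB, hAB⟩ := Filter.disjoint_iff.1 (hdisj _ (e ⟨p, hpC⟩).2)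
        obtain ⟨A', hA'A, hA'o, hpA'⟩ := _root_.mem_nhds_iff.1 hA
        have hopen : IsOpen {c : C | (e c : ℝ) ∈ A'} :=
          hA'o.preimage (continuous_subtype_val.comp e.continuous)
        obtain ⟨O, hO, hOeq⟩ := isOpen_induced_iff.1 hopen
        refine ⟨O, hO.mem_nhds ?_, Oᶜ, ?_, disjoint_compl_right⟩
        · have : (⟨p, hpC⟩ : C) ∈ Subtype.val ⁻¹' O := by rw [hOeq]; exact hpA'
          exact this
        · rw [Filter.mem_map]
          filter_upwards [hB, hmem] with t htB ht htO
          have : (⟨g t, hgmem t ht⟩ : C) ∈ Subtype.val ⁻¹' O := htO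
          rw [hOeq] at this
          have heq : (⟨g t, hgmem t ht⟩ : C) = e.symm ⟨t, ht⟩ := Subtype.ext (hgt t ht)
          rw [heq, mem_ofPred_eq, e.apply_symm_apply] at this
          exact Set.disjoint_left.1 hAB (hA'A this) htB
      · have hpcl : p ∉ closure C := fun h' =>
          (closure_connectedComponentIn_compl_subset x hx h').elim hpC hpV
        refine ⟨(closure C)ᶜ, isClosed_closure.isOpen_compl.mem_nhds hpcl, closure C, ?_,
          disjoint_compl_left⟩
        rw [Filter.mem_map]
        filter_upwards [hmem] with t ht
        exact subset_closure (hgmem t ht)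
  obtain ⟨v, hv, hgv⟩ := hlim (𝓝[>] 0) inferInstance (Ioo_mem_nhdsGT one_pos)
    (fun s hs => Filter.disjoint_iff.2 ⟨Ioi (s / 2), Ioi_mem_nhds (by linarith [hs.1]), Iio (s / 2),
      mem_nhdsWithin_of_mem_nhds (Iio_mem_nhds (by linarith [hs.1])),
      Set.disjoint_left.2 fun t h1 h2 => lt_asymm (mem_Ioi.1 h1) (mem_Iio.1 h2)⟩)
    (fun S hS => by
      obtain ⟨c, hc, hcS⟩ := mem_nhdsGT_iff_exists_Ioo_subset.1 hS
      refine ⟨Ioo 0 (min c 1), Ioo_mem_nhdsGT (lt_min hc one_pos),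
        (Ioo_subset_Ioo le_rfl (min_le_left _ _)).trans hcS,
        Ioo_subset_Ioo le_rfl (min_le_right _ _), isPreconnected_Ioo⟩)
  obtain ⟨w, hw, hgw⟩ := hlim (𝓝[<] 1) inferInstance (Ioo_mem_nhdsLT one_pos)
    (fun s hs => Filter.disjoint_iff.2 ⟨Iio ((s + 1) / 2), Iio_mem_nhds (by linarith [hs.2]),
      Ioi ((s + 1) / 2), mem_nhdsWithin_of_mem_nhds (Ioi_mem_nhds (by linarith [hs.2])),
      Set.disjoint_left.2 fun t h1 h2 => lt_asymm (mem_Iio.1 h1) (mem_Ioi.1 h2)⟩)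
    (fun S hS => by
      obtain ⟨c, hc, hcS⟩ := mem_nhdsLT_iff_exists_Ioo_subset.1 hS
      refine ⟨Ioo (max c 0) 1, Ioo_mem_nhdsLT (max_lt hc one_pos),
        (Ioo_subset_Ioo (le_max_left _ _) le_rfl).trans hcS,
        Ioo_subset_Ioo (le_max_right _ _) le_rfl, isPreconnected_Ioo⟩)
  have hext := continuousOn_Icc_extendFrom_Ioo hgcont hgv hgw
  set k := extendFrom (Ioo (0 : ℝ) 1) g with hk
  set h : ℝ → G := IccExtend (zero_le_one' ℝ) ((Icc (0 : ℝ) 1).domRestrict k) with hh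
  have hhk : ∀ t ∈ Icc (0 : ℝ) 1, h t = k t := fun t ht => IccExtend_of_mem _ _ ht
  have hhg : EqOn h g (Ioo 0 1) := fun t ht => by
    rw [hhk t (Ioo_subset_Icc_self ht)]
    exact extendFrom_extends hgcont t ht
  refine ⟨h, ⟨(continuousOn_iff_continuous_domRestrict.1 hext).Icc_extend', ?_, ?_,
    hginj.congr hhg.symm, fun t ht => ?_⟩, by rw [hhg.image_eq, hgimg]⟩
  · rw [hhk 0 (by simp), hk, eq_lim_at_left_extendFrom_Ioo zero_lt_one hgv]
    exact hv
  · rw [hhk 1 (by simp), hk, eq_lim_at_right_extendFrom_Ioo zero_lt_one hgw]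
    exact hw
  · rw [hhg ht]
    exact connectedComponentIn_subset _ _ (hgmem t ht)

variable {h h' : ℝ → G}

lemma IsEdgeParam.injOn_Ico (hh : IsEdgeParam V h) : InjOn h (Ico 0 1) := by
  rw [← Ioo_insert_left (zero_lt_one' ℝ), injOn_insert left_notMem_Ioo]
  refine ⟨hh.injOn, ?_⟩
  rintro ⟨t, ht, htV⟩
  exact hh.notMem t ht (htV ▸ hh.zero_mem)

lemma IsEdgeParam.zero_ne_one (hG : IsTopGraph V) (hh : IsEdgeParam V h) : h 0 ≠ h 1 := by
  intro h01
  have h3 := hG.circle_vertices _ (isCircle_image hh.continuous.continuousOn h01 hh.injOn_Ico)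
  have hsub : h '' Ico 0 1 ∩ V ⊆ {h 0} := by
    rintro _ ⟨⟨t, ht, rfl⟩, htV⟩
    rcases ht.1.eq_or_lt with rfl | h0
    · rfl
    · exact absurd htV (hh.notMem t ⟨h0, ht.2⟩)
  have h1 := ncard_le_ncard hsub
  rw [ncard_singleton] at h1
  omega

lemma IsEdgeParam.injOn_Icc (hG : IsTopGraph V) (hh : IsEdgeParam V h) : InjOn h (Icc 0 1) := by
  rw [← Ico_insert_right (zero_le_one' ℝ), injOn_insert right_notMem_Ico]
  refine ⟨hh.injOn_Ico, ?_⟩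
  rintro ⟨t, ht, htV⟩
  rcases ht.1.eq_or_lt with rfl | h0
  · exact hh.zero_ne_one hG htV
  · exact hh.notMem t ⟨h0, ht.2⟩ (htV ▸ hh.one_mem)

/-- Two disjoint edges do not have the same end points. -/
lemma IsEdgeParam.endpoints_ne (hG : IsTopGraph V) (hh : IsEdgeParam V h) (hh' : IsEdgeParam V h')
    (hdisj : Disjoint (h '' Ioo 0 1) (h' '' Ioo 0 1)) (h0 : h 0 = h' 0) : h 1 ≠ h' 1 := by
  intro h1
  set k : ℝ → G := fun t => if t ≤ 1 / 2 then h (2 * t) else h' (2 - 2 * t) with hk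
  have hk1 : ∀ t ≤ (1 / 2 : ℝ), k t = h (2 * t) := fun t ht => if_pos ht
  have hk2 : ∀ t, (1 / 2 : ℝ) < t → k t = h' (2 - 2 * t) := fun t ht => if_neg ht.not_ge
  have hkc : Continuous k := by
    refine Continuous.if_le (hh.continuous.comp (by fun_prop)) (hh'.continuous.comp (by fun_prop))
      continuous_id continuous_const ?_
    rintro t rfl
    norm_num [h1]
  have hmix : ∀ s t : ℝ, 0 ≤ s → s ≤ 1 / 2 → 1 / 2 < t → t < 1 → k s ≠ k t := by
    intro s t hs0 hs ht ht1 hst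
    rw [hk1 s hs, hk2 t ht] at hst
    have ht' : 2 - 2 * t ∈ Ioo (0 : ℝ) 1 := ⟨by linarith, by linarith⟩
    have hV := hh'.notMem _ ht'
    rw [← hst] at hV
    have hs' : 2 * s ∈ Ioo (0 : ℝ) 1 := by
      refine ⟨lt_of_le_of_ne (by linarith) ?_, lt_of_le_of_ne (by linarith) ?_⟩
      · intro h2
        exact hV (h2 ▸ hh.zero_mem)
      · intro h2
        exact hV (h2 ▸ hh.one_mem)
    exact Set.disjoint_left.1 hdisj ⟨_, hs', rfl⟩ ⟨_, ht', hst.symm⟩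
  have hinj : InjOn k (Ico 0 1) := by
    intro s hs t ht hst
    rcases le_or_gt s (1 / 2) with hs2 | hs2 <;> rcases le_or_gt t (1 / 2) with ht2 | ht2
    · rw [hk1 s hs2, hk1 t ht2] at hst
      have := hh.injOn_Icc hG ⟨by linarith [hs.1], by linarith⟩ ⟨by linarith [ht.1], by linarith⟩ hst
      linarith
    · exact absurd hst (hmix s t hs.1 hs2 ht2 ht.2)
    · exact absurd hst.symm (hmix t s ht.1 ht2 hs2 hs.2)
    · rw [hk2 s hs2, hk2 t ht2] at hst
      have := hh'.injOn ⟨by linarith [hs.2], by linarith⟩ ⟨by linarith [ht.2], by linarith⟩ hst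
      linarith
  have hk01 : k 0 = k 1 := by
    rw [hk1 0 (by norm_num), hk2 1 (by norm_num)]
    norm_num [h0]
  have h3 := hG.circle_vertices _ (isCircle_image hkc.continuousOn hk01 hinj)
  have hsub : k '' Ico 0 1 ∩ V ⊆ {h 0, h 1} := by
    rintro _ ⟨⟨t, ht, rfl⟩, htV⟩
    rcases le_or_gt t (1 / 2) with ht2 | ht2
    · rw [hk1 t ht2] at htV ⊢
      by_contra hne
      refine hh.notMem (2 * t) ⟨lt_of_le_of_ne (by linarith [ht.1]) ?_,
        lt_of_le_of_ne (by linarith) ?_⟩ htV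
      · intro h2
        exact hne (by rw [← h2]; simp)
      · intro h2
        exact hne (by rw [h2]; simp)
    · rw [hk2 t ht2] at htV
      exact absurd htV (hh'.notMem _ ⟨by linarith [ht.2], by linarith⟩)
  have h2 := (ncard_le_ncard hsub (toFinite _)).trans (ncard_insert_le _ _)
  rw [ncard_singleton] at h2
  omega

/-- The complement of the vertex set has finitely many components. -/
lemma IsTopGraph.finite_components (hG : IsTopGraph V) :
    (connectedComponentIn Vᶜ '' Vᶜ).Finite := by
  have hex : ∀ x : ↥Vᶜ, ∃ h : ℝ → G, IsEdgeParam V h ∧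
      h '' Ioo 0 1 = connectedComponentIn Vᶜ (x : G) := fun x => hG.exists_param x.2
  choose h hh himg using hex
  have hfin : (range fun x : ↥Vᶜ => ((h x 0, h x 1) : G × G)).Finite :=
    (hG.finite_vertexSet.prod hG.finite_vertexSet).subset <| range_subset_iff.2
      fun x => ⟨(hh x).zero_mem, (hh x).one_mem⟩
  obtain ⟨T, -, hTeq⟩ :=
    exists_subset_bijOn univ (fun x : ↥Vᶜ => ((h x 0, h x 1) : G × G))
  have hT : T.Finite := Finite.of_finite_image (hfin.subset (image_subset_range _ _)) hTeq.injOn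
  refine (hT.image fun x : ↥Vᶜ => connectedComponentIn Vᶜ (x : G)).subset ?_
  rintro _ ⟨x, hx, rfl⟩
  obtain ⟨y, hy, hyx⟩ := hTeq.surjOn (mem_image_of_mem _ (mem_univ (⟨x, hx⟩ : ↥Vᶜ)))
  refine ⟨y, hy, ?_⟩
  by_contra hne
  have hdisj : Disjoint (h y '' Ioo 0 1) (h ⟨x, hx⟩ '' Ioo 0 1) := by
    rw [himg, himg]
    refine Set.disjoint_left.2 fun z hzy hzx => hne ?_
    exact (connectedComponentIn_eq hzy).trans (connectedComponentIn_eq hzx).symm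
  rw [Prod.mk.injEq] at hyx
  exact (hh y).endpoints_ne hG (hh ⟨x, hx⟩) hdisj hyx.1 hyx.2

/-- The components of the complement of the vertex set are open. -/
lemma IsTopGraph.isOpen_component (hG : IsTopGraph V) (x : G) :
    IsOpen (connectedComponentIn Vᶜ x) := by
  set C := connectedComponentIn Vᶜ x with hC
  have hcl : IsClosed (V ∪ ⋃ D ∈ (connectedComponentIn Vᶜ '' Vᶜ) \ {C}, closure D) :=
    hG.finite_vertexSet.isClosed.union
      (hG.finite_components.sdiff.isClosed_biUnion fun _ _ => isClosed_closure)
  convert hcl.isOpen_compl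
  ext y
  constructor
  · rintro hy (hyV | hyD)
    · exact connectedComponentIn_subset _ _ hy hyV
    · obtain ⟨D, ⟨⟨z, hz, rfl⟩, hne⟩, hyD⟩ := mem_iUnion₂.1 hyD
      rcases closure_connectedComponentIn_compl_subset z hz hyD with hyz | hyV
      · exact hne ((connectedComponentIn_eq hyz).trans (connectedComponentIn_eq hy).symm)
      · exact connectedComponentIn_subset _ _ hy hyV
  · intro hy
    by_contra hyC
    have hyV : y ∈ Vᶜ := fun h => hy (Or.inl h)
    refine hy (Or.inr (mem_iUnion₂.2 ⟨connectedComponentIn Vᶜ y, ⟨⟨y, hyV, rfl⟩, ?_⟩,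
      subset_closure (mem_connectedComponentIn hyV)⟩))
    intro heq
    exact hyC (heq ▸ mem_connectedComponentIn hyV)

/-- Every component of the complement of the vertex set is the image of an edge map. -/
lemma IsTopGraph.exists_isEdgeMap (hG : IsTopGraph V) {x : G} (hx : x ∈ Vᶜ) :
    ∃ h : ℝ → G, IsEdgeMap h ∧ h '' Ioo 0 1 = connectedComponentIn Vᶜ x := by
  obtain ⟨h, hh, himg⟩ := hG.exists_param hx
  refine ⟨h, ⟨hh.continuous, hh.injOn, fun U hU hUo => ?_⟩, himg⟩
  have hcl : IsClosed (h '' (Icc 0 1 \ U)) :=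
    ((isCompact_Icc.diff hUo).image hh.continuous).isClosed
  convert (hG.isOpen_component x).inter hcl.isOpen_compl
  rw [← himg]
  ext y
  constructor
  · rintro ⟨t, ht, rfl⟩
    refine ⟨⟨t, hU ht, rfl⟩, ?_⟩
    rintro ⟨s, ⟨hs, hsU⟩, hst⟩
    exact hsU (hh.injOn_Icc hG hs (Ioo_subset_Icc_self (hU ht)) hst ▸ ht)
  · rintro ⟨⟨t, ht, rfl⟩, hy⟩
    by_contra hne
    exact hy ⟨t, ⟨Ioo_subset_Icc_self ht, fun htU => hne ⟨t, htU, rfl⟩⟩, rfl⟩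

end GraphStructure

/-- In a graph, the recurrent points outside the closure of the periodic points stay away from the
closure of the periodic points. -/
lemma IsTopGraph.disjoint_closure {G : Type*} [MetricSpace G] {V : Set G} (hG : IsTopGraph V)
    {f : G → G} (hf : Continuous f) :
    Disjoint (closure (recurrentPts f \ closure (periodicPts f))) (closure (periodicPts f)) := by
  set A := recurrentPts f \ closure (periodicPts f) with hA
  have hsub : A ⊆ (A ∩ V) ∪ ⋃ C ∈ connectedComponentIn Vᶜ '' Vᶜ, A ∩ C := by
    intro y hy
    by_cases hyV : y ∈ V
    · exact Or.inl ⟨hy, hyV⟩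
    · exact Or.inr (mem_iUnion₂.2 ⟨_, ⟨y, hyV, rfl⟩, hy, mem_connectedComponentIn hyV⟩)
  refine Disjoint.mono_left (closure_mono hsub) ?_
  rw [closure_union, hG.finite_components.closure_biUnion,
    (hG.finite_vertexSet.inter_of_right A).isClosed.closure_eq, disjoint_union_left,
    disjoint_iUnion₂_left]
  refine ⟨Set.disjoint_left.2 fun y hy => hy.1.2, ?_⟩
  rintro _ ⟨x, hx, rfl⟩
  obtain ⟨h, hh, himg⟩ := hG.exists_isEdgeMap hx
  rw [← himg]
  exact hh.disjoint_closure hf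

section SetDist

variable {G : Type*} [MetricSpace G] {A A' B : Set G}

lemma bddBelow_dist (A B : Set G) : BddBelow {r : ℝ | ∃ a ∈ A, ∃ b ∈ B, dist a b = r} :=
  ⟨0, by rintro _ ⟨a, -, b, -, rfl⟩; exact dist_nonneg⟩

lemma setDist_le_dist {a b : G} (ha : a ∈ A) (hb : b ∈ B) : setDist A B ≤ dist a b :=
  csInf_le (bddBelow_dist A B) ⟨a, ha, b, hb, rfl⟩

lemma le_setDist (hA : A.Nonempty) (hB : B.Nonempty) {δ : ℝ}
    (h : ∀ a ∈ A, ∀ b ∈ B, δ ≤ dist a b) : δ ≤ setDist A B := by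
  obtain ⟨a, ha⟩ := hA
  obtain ⟨b, hb⟩ := hB
  refine le_csInf ⟨_, a, ha, b, hb, rfl⟩ ?_
  rintro _ ⟨a, ha, b, hb, rfl⟩
  exact h a ha b hb

lemma setDist_eq_of_subset_closure (hA : A.Nonempty) (hB : B.Nonempty) (hsub : A ⊆ A')
    (hsub' : A' ⊆ closure A) : setDist A B = setDist A' B := by
  apply le_antisymm
  · refine le_setDist (hA.mono hsub) hB fun a ha b hb => ?_
    have hcl : IsClosed {y | setDist A B ≤ dist y b} :=
      isClosed_le continuous_const (by fun_prop)
    exact closure_minimal (fun y hy => setDist_le_dist hy hb) hcl (hsub' ha)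
  · exact le_setDist hA hB fun a ha b hb => setDist_le_dist (hsub ha) hb

lemma setDist_pos [CompactSpace G] (hA : A.Nonempty) (hB : B.Nonempty)
    (hdisj : Disjoint (closure A) (closure B)) : 0 < setDist A B := by
  obtain ⟨δ, hδ, h⟩ := hdisj.exists_thickenings isClosed_closure.isCompact isClosed_closure
  refine hδ.trans_le (le_setDist hA hB fun a ha b hb => ?_)
  by_contra! hlt
  exact Set.disjoint_left.1 h (self_subset_thickening hδ _ (subset_closure ha))
    (mem_thickening_iff.2 ⟨b, subset_closure hb, hlt⟩)

end SetDist

/-- if `P(f) ≠ ∅` and `R(f) − cl(P(f)) ≠ ∅`, then the distance from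
`R(f) − cl(P(f))` to `cl(P(f))` equals that from `cl(R(f)) − cl(P(f))` to `cl(P(f))`
and is strictly positive. -/
theorem dist_recurrent_periodic_pos {G : Type*} [MetricSpace G] (V : Set G)
    (hG : IsTopGraph V) (f : G → G) (hf : Continuous f)
    (hP : (Function.periodicPts f).Nonempty)
    (hR : (recurrentPts f \ closure (Function.periodicPts f)).Nonempty) :
    setDist (recurrentPts f \ closure (Function.periodicPts f))
        (closure (Function.periodicPts f)) =
      setDist (closure (recurrentPts f) \ closure (Function.periodicPts f))
        (closure (Function.periodicPts f)) ∧
    0 < setDist (recurrentPts f \ closure (Function.periodicPts f))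
        (closure (Function.periodicPts f)) := by
  have := hG.compact
  refine ⟨setDist_eq_of_subset_closure hR hP.closure (sdiff_subset_sdiff_left subset_closure) ?_,
    setDist_pos hR hP.closure ?_⟩
  · rintro y ⟨hyR, hyP⟩
    have hy : y ∈ (closure (periodicPts f))ᶜ ∩ closure (recurrentPts f) := ⟨hyP, hyR⟩
    refine closure_mono ?_ (isClosed_closure.isOpen_compl.inter_closure hy)
    exact fun z hz => ⟨hz.2, hz.1⟩
  · rw [isClosed_closure.closure_eq]
    exact hG.disjoint_closure hf
end
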